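/- arXiv:1109.1617 — 3 statements merged into one kernel-verified Lean document; each statement's English description precedes it below -/
import Mathlib

section
/- Let 0 < δ₁ < δ₂ with δ₂ − δ₁ < 1, let I = [δ₁,δ₂], let H : I → (0,1) be continuous and set b = max_{s∈I} H(s). For s ∈ I let g_s : ℝ → ℝ be given by g_s(x) = (s−x)₊^{H(s)−1/2} log((s−x)₊) − (−x)₊^{H(s)−1/2} log((−x)₊). Let {Y(s)}_{s∈I} be a centered Gaussian process with almost surely continuous sample paths and covariance E[Y(s)Y(t)] = ∫_ℝ g_s(x) g_t(x) dx for all s,t ∈ I. Then there exists an event D with P(D) > 0 such that for every ω ∈ D, the zero-level set { s ∈ I : Y(s,ω) = 0 } has Hausdorff dimension at least 1 − b. -/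
open MeasureTheory ProbabilityTheory Filter Set Topology

noncomputable section

/-- `y₊^{h−1/2} log(y₊)`: equals `y^{h−1/2} log y` if `y > 0` and `0` otherwise. -/
def logKernel (h y : ℝ) : ℝ := if 0 < y then y ^ (h - 1/2) * Real.log y else 0

/-- The integrand `g_s` of the paper, depending on a functional parameter `H`. -/
def gKer (H : ℝ → ℝ) (s x : ℝ) : ℝ :=
  logKernel (H s) (s - x) - logKernel (H s) (-x)

open scoped ENNReal NNReal

/-- Energy method: if measures with mass at least `a` and `γ`-energy at most `K` are carried by
arbitrarily small open neighbourhoods of `Z`, then `Z` has nonzero `γ`-Hausdorff measure. -/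
lemma aux_energy {γ : ℝ} (hγ : 0 < γ) (Z : Set ℝ) (a K : ℝ≥0∞) (ha : a ≠ 0) (hK : K ≠ ∞)
    (h : ∀ U : Set ℝ, IsOpen U → Z ⊆ U → ∃ μ : Measure ℝ, μ Uᶜ = 0 ∧ a ≤ μ univ ∧
      ∫⁻ s, ∫⁻ t, edist s t ^ (-γ) ∂μ ∂μ ≤ K) :
    Measure.hausdorffMeasure γ Z ≠ 0 := by
  intro h0
  -- wlog a finite
  obtain ⟨a', ha'0, ha'a⟩ : ∃ a' : ℝ≥0, 0 < a' ∧ (a' : ℝ≥0∞) ≤ a := by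
    obtain ⟨x, hx0, hxa⟩ := ENNReal.lt_iff_exists_nnreal_btwn.1 (pos_iff_ne_zero.2 ha)
    exact ⟨x, by exact_mod_cast hx0, hxa.le⟩
  lift K to ℝ≥0 using hK
  -- choose the parameters
  set l : ℝ≥0 := 4 * (K + 1) / a' with hl
  have hlpos : 0 < l := by positivity
  set η : ℝ≥0 := a' / (8 * l) with hη
  have hηpos : 0 < η := by positivity
  rw [Measure.hausdorffMeasure_apply] at h0
  have h1 := (iSup₂_le_iff.1 h0.le) 1 one_pos
  have h2 : (⨅ (t : ℕ → Set ℝ) (_ : Z ⊆ ⋃ n, t n) (_ : ∀ n, Metric.ediam (t n) ≤ 1),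
          ∑' n, ⨆ _ : (t n).Nonempty, Metric.ediam (t n) ^ γ) < (η : ℝ≥0∞) :=
    lt_of_le_of_lt h1 (by exact_mod_cast hηpos)
  simp only [iInf_lt_iff] at h2
  obtain ⟨t, htZ, htd, hts⟩ := h2
  obtain ⟨e, he0, hes⟩ := ENNReal.exists_pos_sum_of_countable
    (ε := (η : ℝ≥0∞)) (by exact_mod_cast hηpos.ne') ℕ
  have hU : ∀ n, ∃ (U : Set ℝ) (d : ℝ≥0∞), IsOpen U ∧ t n ⊆ U ∧ Metric.ediam U ≤ d ∧ d ≠ 0 ∧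
      d ≠ ∞ ∧ d ^ γ ≤ (⨆ _ : (t n).Nonempty, Metric.ediam (t n) ^ γ) + e n := by
    intro n
    have hc : Tendsto (fun x : ℝ => (Metric.ediam (t n) + ENNReal.ofReal x + ENNReal.ofReal x) ^ γ)
        (𝓝[>] 0) (𝓝 (Metric.ediam (t n) ^ γ)) := by
      have : Continuous (fun x : ℝ =>
          (Metric.ediam (t n) + ENNReal.ofReal x + ENNReal.ofReal x) ^ γ) := by
        refine ENNReal.continuous_rpow_const.comp ?_
        have := ENNReal.continuous_ofReal
        fun_prop
      have h3 := this.tendsto 0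
      simp only [ENNReal.ofReal_zero, add_zero] at h3
      exact h3.mono_left nhdsWithin_le_nhds
    have hfin : Metric.ediam (t n) ≠ ∞ := ne_top_of_le_ne_top ENNReal.one_ne_top (htd n)
    have hlt : Metric.ediam (t n) ^ γ < Metric.ediam (t n) ^ γ + e n := by
      refine ENNReal.lt_add_right (ENNReal.rpow_ne_top_of_nonneg hγ.le hfin) ?_
      exact_mod_cast (he0 n).ne'
    obtain ⟨x, hx, hx0⟩ := ((hc.eventually (gt_mem_nhds hlt)).and self_mem_nhdsWithin).exists
    have hx0' : 0 < x := hx0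
    refine ⟨Metric.thickening x (t n), Metric.ediam (t n) + ENNReal.ofReal x + ENNReal.ofReal x,
      Metric.isOpen_thickening, Metric.self_subset_thickening hx0' _, ?_, ?_, ?_, ?_⟩
    · refine Metric.ediam_le fun y hy z hz => ?_
      obtain ⟨y', hy', hyy⟩ := Metric.mem_thickening_iff.1 hy
      obtain ⟨z', hz', hzz⟩ := Metric.mem_thickening_iff.1 hz
      calc edist y z ≤ edist y y' + edist y' z' + edist z' z := edist_triangle4 _ _ _ _
        _ ≤ ENNReal.ofReal x + Metric.ediam (t n) + ENNReal.ofReal x := by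
            gcongr
            · rw [edist_dist]; exact ENNReal.ofReal_le_ofReal hyy.le
            · exact Metric.edist_le_ediam_of_mem hy' hz'
            · rw [edist_comm, edist_dist]; exact ENNReal.ofReal_le_ofReal hzz.le
        _ = _ := by ring
    · have : ENNReal.ofReal x ≠ 0 := by simpa using hx0'
      simp [this]
    · simp [hfin]
    · rcases (t n).eq_empty_or_nonempty with hemp | hne
      · rw [hemp] at hx
        simp only [Metric.ediam_empty] at hx ⊢
        rw [ENNReal.zero_rpow_of_pos hγ] at hx
        simpa [hemp] using hx.le
      · simpa [hne] using hx.le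
  choose U d hUo htU hUd hd0 hdt hdγ using hU
  have hsum : ∑' n, d n ^ γ ≤ 2 * η := by
    calc ∑' n, d n ^ γ ≤ ∑' n, ((⨆ _ : (t n).Nonempty, Metric.ediam (t n) ^ γ) + e n) :=
          ENNReal.tsum_le_tsum hdγ
      _ = _ := ENNReal.tsum_add
      _ ≤ η + η := add_le_add hts.le hes.le
      _ = _ := by ring
  obtain ⟨μ, hμ0, hμa, hμK⟩ := h (⋃ n, U n) (isOpen_iUnion hUo)
    (htZ.trans (iUnion_mono htU))
  set V := disjointed U with hV
  have hVm : ∀ n, MeasurableSet (V n) := MeasurableSet.disjointed fun n => (hUo n).measurableSet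
  have hVU : ∀ n, V n ⊆ U n := disjointed_subset U
  have hVd : Pairwise (Function.onFun Disjoint V) := disjoint_disjointed U
  have hmass : μ univ ≤ ∑' n, μ (V n) := by
    have : (univ : Set ℝ) = (⋃ n, U n) ∪ (⋃ n, U n)ᶜ := (union_compl_self _).symm
    rw [this]
    refine (measure_union_le _ _).trans ?_
    rw [hμ0, add_zero, ← iUnion_disjointed]
    exact measure_iUnion_le _
  set E : ℕ → ℝ≥0∞ := fun n => ∫⁻ s in V n, ∫⁻ t, edist s t ^ (-γ) ∂μ ∂μ with hE
  have hEsum : ∑' n, E n ≤ K := by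
    rw [hE, ← lintegral_iUnion hVm hVd]
    exact (setLIntegral_le_lintegral _ _).trans hμK
  have hEn : ∀ n, (d n ^ γ)⁻¹ * μ (V n) * μ (V n) ≤ E n := by
    intro n
    have : ∀ s ∈ V n, (d n ^ γ)⁻¹ * μ (V n) ≤ ∫⁻ t, edist s t ^ (-γ) ∂μ := by
      intro s hs
      calc (d n ^ γ)⁻¹ * μ (V n) = ∫⁻ t in V n, (d n ^ γ)⁻¹ ∂μ := by simp
        _ ≤ ∫⁻ t in V n, edist s t ^ (-γ) ∂μ := by
            refine setLIntegral_mono' (hVm n) fun t ht => ?_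
            rw [ENNReal.rpow_neg]
            refine ENNReal.inv_le_inv.2 (ENNReal.rpow_le_rpow ?_ hγ.le)
            exact (Metric.edist_le_ediam_of_mem (hVU n hs) (hVU n ht)).trans (hUd n)
        _ ≤ _ := setLIntegral_le_lintegral _ _
    calc _ = ∫⁻ s in V n, (d n ^ γ)⁻¹ * μ (V n) ∂μ := by simp
      _ ≤ _ := setLIntegral_mono' (hVm n) this
  have hl0 : (l : ℝ≥0∞) ≠ 0 := by exact_mod_cast hlpos.ne'
  have hkey : ∀ n, μ (V n) ≤ l * d n ^ γ + (l : ℝ≥0∞)⁻¹ * E n := by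
    intro n
    have hdp0 : d n ^ γ ≠ 0 := by simp [hd0 n, hdt n]
    have hdpt : d n ^ γ ≠ ∞ := ENNReal.rpow_ne_top_of_nonneg hγ.le (hdt n)
    rcases le_total (μ (V n)) (l * d n ^ γ) with hle | hle
    · exact hle.trans le_self_add
    · refine le_trans ?_ le_add_self
      calc μ (V n) = (l : ℝ≥0∞)⁻¹ * ((d n ^ γ)⁻¹ * (l * d n ^ γ) * μ (V n)) := by
            rw [mul_comm (l : ℝ≥0∞) (d n ^ γ), ← mul_assoc (d n ^ γ)⁻¹,
              ENNReal.inv_mul_cancel hdp0 hdpt, one_mul, ← mul_assoc,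
              ENNReal.inv_mul_cancel hl0 ENNReal.coe_ne_top, one_mul]
        _ ≤ (l : ℝ≥0∞)⁻¹ * ((d n ^ γ)⁻¹ * μ (V n) * μ (V n)) := by gcongr
        _ ≤ _ := by gcongr; exact hEn n
  have hfinal : (a' : ℝ≥0∞) ≤ l * (2 * η) + (l : ℝ≥0∞)⁻¹ * K := by
    calc (a' : ℝ≥0∞) ≤ μ univ := ha'a.trans hμa
      _ ≤ ∑' n, μ (V n) := hmass
      _ ≤ ∑' n, (l * d n ^ γ + (l : ℝ≥0∞)⁻¹ * E n) := ENNReal.tsum_le_tsum hkey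
      _ = l * ∑' n, d n ^ γ + (l : ℝ≥0∞)⁻¹ * ∑' n, E n := by
          rw [ENNReal.tsum_add, ENNReal.tsum_mul_left, ENNReal.tsum_mul_left]
      _ ≤ _ := by gcongr
  rw [← ENNReal.coe_inv hlpos.ne'] at hfinal
  have hfinal' : a' ≤ l * (2 * η) + l⁻¹ * K := by exact_mod_cast hfinal
  have e1 : l * (2 * η) = a' / 4 := by rw [hη]; field_simp; norm_num
  have e2 : l⁻¹ * K ≤ a' / 4 := by
    rw [hl]
    rw [inv_div, div_mul_eq_mul_div, div_le_div_iff₀ (by positivity) (by positivity)]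
    have : a' * K * 4 ≤ a' * (4 * (K+1)) := by
      rw [mul_assoc, mul_comm K 4]; gcongr; simp
    exact this
  have : a' ≤ a' / 4 + a' / 4 := by
    calc a' ≤ _ := hfinal'
      _ ≤ _ := by rw [e1]; gcongr
  have h5 : (a' : ℝ) ≤ a' / 4 + a' / 4 := by exact_mod_cast this
  have h6 : (0 : ℝ) < a' := by exact_mod_cast ha'0
  linarith

/-- Second moment argument. -/
lemma aux_second_moment {Ω : Type*} [MeasurableSpace Ω] (P : Measure Ω) [IsProbabilityMeasure P]
    (X W : ℕ → Ω → ℝ≥0∞) (hX : ∀ n, Measurable (X n)) (hW : ∀ n, Measurable (W n))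
    (hXW : ∀ n ω, X n ω * X n ω ≤ W n ω) (m C : ℝ≥0∞) (hm : m ≠ 0) (hC : C ≠ ∞)
    (hXm : ∀ n, m ≤ ∫⁻ ω, X n ω ∂P) (hWC : ∀ n, ∫⁻ ω, W n ω ∂P ≤ C) :
    ∃ (a K : ℝ≥0∞) (D : Set Ω), a ≠ 0 ∧ K ≠ ∞ ∧ 0 < P D ∧
      ∀ ω ∈ D, ∃ᶠ n in atTop, a ≤ X n ω ∧ W n ω ≤ K := by
  obtain ⟨m', hm'0, hm'm⟩ : ∃ a' : ℝ≥0, 0 < a' ∧ (a' : ℝ≥0∞) ≤ m := by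
    obtain ⟨x, hx0, hxa⟩ := ENNReal.lt_iff_exists_nnreal_btwn.1 (pos_iff_ne_zero.2 hm)
    exact ⟨x, by exact_mod_cast hx0, hxa.le⟩
  lift C to ℝ≥0 using hC
  set L : ℝ≥0 := 4 * (C + 1) / m' with hL
  have hLpos : 0 < L := by positivity
  have hL0 : (L : ℝ≥0∞) ≠ 0 := by exact_mod_cast hLpos.ne'
  set a : ℝ≥0 := m' / 4 with ha
  set K : ℝ≥0∞ := (L : ℝ≥0∞) * L with hK
  have hK0 : K ≠ 0 := mul_ne_zero hL0 hL0
  have hKt : K ≠ ∞ := ENNReal.mul_ne_top ENNReal.coe_ne_top ENNReal.coe_ne_top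
  set A : ℕ → Set Ω := fun n => {ω | (a : ℝ≥0∞) ≤ X n ω ∧ W n ω ≤ K} with hA
  have hAm : ∀ n, MeasurableSet (A n) := fun n =>
    (measurableSet_le measurable_const (hX n)).inter (measurableSet_le (hW n) measurable_const)
  have hpt : ∀ n ω, X n ω ≤ a + (A n).indicator (fun _ => (L : ℝ≥0∞)) ω
      + (L : ℝ≥0∞)⁻¹ * W n ω := by
    intro n ω
    by_cases h1 : (a : ℝ≥0∞) ≤ X n ω
    · by_cases h2 : W n ω ≤ K
      · have : ω ∈ A n := ⟨h1, h2⟩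
        rw [indicator_of_mem this]
        have hXL : X n ω ≤ L := by
          by_contra hlt
          push Not at hlt
          have : K < X n ω * X n ω := ENNReal.mul_lt_mul hlt hlt
          exact absurd ((hXW n ω).trans h2) (not_le.2 this)
        exact hXL.trans (le_add_self.trans le_self_add)
      · push Not at h2
        refine le_trans ?_ le_add_self
        rcases le_total (X n ω) L with h3 | h3
        · calc X n ω ≤ L := h3
            _ = (L : ℝ≥0∞)⁻¹ * K := by
              rw [hK, ← mul_assoc, ENNReal.inv_mul_cancel hL0 ENNReal.coe_ne_top, one_mul]
            _ ≤ _ := by gcongr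
        · calc X n ω = (L : ℝ≥0∞)⁻¹ * (L * X n ω) := by
                rw [← mul_assoc, ENNReal.inv_mul_cancel hL0 ENNReal.coe_ne_top, one_mul]
            _ ≤ (L : ℝ≥0∞)⁻¹ * (X n ω * X n ω) := by gcongr
            _ ≤ _ := by gcongr; exact hXW n ω
    · push Not at h1
      exact h1.le.trans (le_self_add.trans le_self_add)
  have hPA : ∀ n, ((m' / (2 * L) : ℝ≥0) : ℝ≥0∞) ≤ P (A n) := by
    intro n
    have h1 : (m' : ℝ≥0∞) ≤ a + L * P (A n) + (L : ℝ≥0∞)⁻¹ * C := by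
      calc (m' : ℝ≥0∞) ≤ ∫⁻ ω, X n ω ∂P := hm'm.trans (hXm n)
        _ ≤ ∫⁻ ω, (a + (A n).indicator (fun _ => (L : ℝ≥0∞)) ω + (L : ℝ≥0∞)⁻¹ * W n ω) ∂P :=
            lintegral_mono (hpt n)
        _ = a + L * P (A n) + (L : ℝ≥0∞)⁻¹ * ∫⁻ ω, W n ω ∂P := by
            rw [lintegral_add_right _ ((hW n).const_mul _), lintegral_const_mul _ (hW n),
              lintegral_add_left measurable_const, lintegral_indicator (hAm n)]
            simp
        _ ≤ _ := by gcongr; exact hWC n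
    have hfin : P (A n) ≠ ∞ := measure_ne_top _ _
    obtain ⟨p, hp⟩ : ∃ p : ℝ≥0, (p : ℝ≥0∞) = P (A n) := ⟨_, ENNReal.coe_toNNReal hfin⟩
    rw [← hp] at h1 ⊢
    rw [← ENNReal.coe_inv hLpos.ne'] at h1
    have h2 : m' ≤ a + L * p + L⁻¹ * C := by exact_mod_cast h1
    have e2 : L⁻¹ * C ≤ m' / 4 := by
      rw [hL, inv_div, div_mul_eq_mul_div, div_le_div_iff₀ (by positivity) (by positivity)]
      have : m' * C * 4 ≤ m' * (4 * (C+1)) := by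
        rw [mul_assoc, mul_comm C 4]; gcongr; simp
      exact this
    rw [ENNReal.coe_le_coe]
    rw [div_le_iff₀ (by positivity)]
    have h3 : (m' : ℝ) ≤ m' / 4 + L * p + L⁻¹ * C := by exact_mod_cast h2
    have h4 : (L : ℝ)⁻¹ * C ≤ m' / 4 := by exact_mod_cast e2
    have : (m' : ℝ) ≤ p * (2 * L) := by linarith
    exact_mod_cast this
  refine ⟨a, K, ⋂ N, ⋃ n ≥ N, A n, ?_, hKt, ?_, ?_⟩
  · have : 0 < a := by positivity
    exact_mod_cast this.ne'
  · have hanti : Antitone (fun N => ⋃ n ≥ N, A n) := by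
      intro i j hij
      refine iUnion_mono fun n => ?_
      exact iUnion_mono' fun h => ⟨hij.trans h, Subset.rfl⟩
    have ht := tendsto_measure_iInter_atTop (μ := P) (s := fun N => ⋃ n ≥ N, A n)
      (fun N => (MeasurableSet.iUnion fun n => MeasurableSet.iUnion fun _ =>
        hAm n).nullMeasurableSet) hanti ⟨0, measure_ne_top _ _⟩
    have hge : ((m' / (2 * L) : ℝ≥0) : ℝ≥0∞) ≤ P (⋂ N, ⋃ n ≥ N, A n) := by
      refine ge_of_tendsto' ht fun N => (hPA N).trans (measure_mono ?_)
      exact subset_iUnion₂_of_subset N le_rfl Subset.rfl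
    refine lt_of_lt_of_le ?_ hge
    have : 0 < m' / (2 * L) := by positivity
    exact_mod_cast this
  · intro ω hω
    rw [frequently_atTop]
    intro N
    obtain ⟨n, hn, h⟩ := mem_iUnion₂.1 (mem_iInter.1 hω N)
    exact ⟨n, hn, h⟩

lemma aux_gauss_Icc (v : ℝ≥0) (hv : v ≠ 0) (x y : ℝ) :
    gaussianReal 0 v (Icc x y) ≤ ENNReal.ofReal (y - x) * ENNReal.ofReal (Real.sqrt v)⁻¹ := by
  rw [gaussianReal_apply _ hv]
  have hv' : (0:ℝ) < v := by exact_mod_cast pos_iff_ne_zero.2 hv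
  calc ∫⁻ z in Icc x y, gaussianPDF 0 v z
      ≤ ∫⁻ z in Icc x y, ENNReal.ofReal (Real.sqrt v)⁻¹ := by
        refine lintegral_mono fun z => ?_
        rw [gaussianPDF]
        refine ENNReal.ofReal_le_ofReal ?_
        rw [gaussianPDFReal]
        have h1 : Real.exp (-(z - 0) ^ 2 / (2 * v)) ≤ 1 := by
          rw [Real.exp_le_one_iff]
          exact div_nonpos_of_nonpos_of_nonneg (by nlinarith [sq_nonneg (z-0)]) (by positivity)
        have h2 : (Real.sqrt (2 * Real.pi * v))⁻¹ ≤ (Real.sqrt v)⁻¹ := by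
          refine inv_anti₀ (Real.sqrt_pos.2 hv') (Real.sqrt_le_sqrt ?_)
          nlinarith [Real.pi_gt_three]
        calc _ ≤ (Real.sqrt (2 * Real.pi * v))⁻¹ * 1 := by gcongr
          _ ≤ _ := by rw [mul_one]; exact h2
    _ = _ := by simp [mul_comm]

lemma aux_var {Ω : Type*} [MeasurableSpace Ω] {P : Measure Ω} [IsProbabilityMeasure P]
    {X : Ω → ℝ} {v : ℝ≥0} (h : P.map X = gaussianReal 0 v) :
    AEMeasurable X P ∧ MemLp X 2 P ∧ ∫ ω, X ω ∂P = 0 ∧ ∫ ω, X ω * X ω ∂P = v := by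
  have hg : HasGaussianLaw X P := ⟨by rw [h]; infer_instance⟩
  have hm := hg.aemeasurable
  have h0 : ∫ ω, X ω ∂P = 0 := by
    have := integral_map (f := fun x : ℝ => x) hm (by fun_prop)
    rw [← this, h]; simp
  refine ⟨hm, hg.memLp_two, h0, ?_⟩
  have h1 : Var[X; P] = v := by
    have := variance_map (X := id) (μ := P) aemeasurable_id hm
    rw [h, variance_id_gaussianReal] at this
    simpa using this.symm
  rw [variance_of_integral_eq_zero hm h0] at h1
  rw [← h1]
  congr 1; ext ω; simp [pow_two]

lemma aux_gauss {Ω : Type*} [MeasurableSpace Ω] (P : Measure Ω) [IsProbabilityMeasure P]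
    (U V : Ω → ℝ)
    (hUV : ∀ a b : ℝ, ∃ v : ℝ≥0, P.map (fun ω => a * U ω + b * V ω) = gaussianReal 0 v)
    (A B C : ℝ) (hA : ∫ ω, U ω * U ω ∂P = A) (hB : ∫ ω, V ω * V ω ∂P = B)
    (hC : ∫ ω, U ω * V ω ∂P = C) (hdet : 0 < A * B - C ^ 2) (hA0 : 0 < A) (ε : ℝ) (hε : 0 < ε) :
    P {ω | |U ω| ≤ ε ∧ |V ω| ≤ ε} ≤
      ENNReal.ofReal (2 * ε) * ENNReal.ofReal (2 * ε) *
        ENNReal.ofReal (Real.sqrt (A * B - C ^ 2))⁻¹ := by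
  obtain ⟨vU, hvU⟩ := hUV 1 0
  obtain ⟨vV, hvV⟩ := hUV 0 1
  simp only [one_mul, zero_mul, add_zero, zero_add] at hvU hvV
  obtain ⟨mU, LU, iU, qU⟩ := aux_var hvU
  obtain ⟨mV, LV, iV, qV⟩ := aux_var hvV
  set ρ := C / A with hρ
  set R : Ω → ℝ := fun ω => V ω - ρ * U ω with hR
  obtain ⟨vR, hvR⟩ : ∃ v : ℝ≥0, P.map R = gaussianReal 0 v := by
    obtain ⟨v, hv⟩ := hUV (-ρ) 1
    refine ⟨v, ?_⟩
    rw [← hv]; congr 1; ext ω; simp [hR]; ring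
  obtain ⟨mR, LR, iR, qR⟩ := aux_var hvR
  have iUU : Integrable (fun ω => U ω * U ω) P := LU.integrable_mul LU
  have iUV : Integrable (fun ω => U ω * V ω) P := LU.integrable_mul LV
  have iVV : Integrable (fun ω => V ω * V ω) P := LV.integrable_mul LV
  have hUR : ∫ ω, U ω * R ω ∂P = 0 := by
    have : (fun ω => U ω * R ω) = fun ω => U ω * V ω - ρ * (U ω * U ω) := by
      ext ω; simp only [hR]; ring
    rw [this, integral_sub iUV (iUU.const_mul _), integral_const_mul, hA, hC, hρ]
    field_simp; ring
  have hRR : (vR : ℝ) = (A * B - C ^ 2) / A := by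
    rw [← qR]
    have : (fun ω => R ω * R ω) =
        fun ω => V ω * V ω - 2 * ρ * (U ω * V ω) + ρ ^ 2 * (U ω * U ω) := by
      ext ω; simp only [hR]; ring
    have iS : Integrable (fun ω => V ω * V ω - 2 * ρ * (U ω * V ω)) P := iVV.sub (iUV.const_mul _)
    rw [this, integral_add iS (iUU.const_mul _),
      integral_sub iVV (iUV.const_mul _), integral_const_mul, integral_const_mul, hA, hB, hC, hρ]
    field_simp; ring
  have hvUA : (vU : ℝ) = A := by rw [← qU, hA]
  have hvU0 : vU ≠ 0 := by
    intro h; rw [h] at hvUA; simp at hvUA; linarith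
  have hvR0 : vR ≠ 0 := by
    intro h; rw [h] at hRR
    have := div_pos hdet hA0
    rw [← hRR] at this; simp at this
  have hG : HasGaussianLaw (fun ω => (U ω, R ω)) P := by
    constructor
    refine isGaussian_of_map_eq_gaussianReal fun L => ?_
    rw [AEMeasurable.map_map_of_aemeasurable (by fun_prop) (mU.prodMk mR)]
    obtain ⟨v, hv⟩ := hUV (L (1, 0) - ρ * L (0, 1)) (L (0, 1))
    refine ⟨0, v, ?_⟩
    rw [← hv]; congr 1; ext ω
    have : (U ω, R ω) = U ω • ((1 : ℝ), (0 : ℝ)) + R ω • ((0 : ℝ), (1 : ℝ)) := by simp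
    simp only [Function.comp]
    rw [this, map_add, map_smul, map_smul]
    simp only [hR, smul_eq_mul]; ring
  have hind : IndepFun U R P := by
    refine hG.indepFun_of_covariance_eq_zero ?_
    rw [covariance_eq_sub LU LR]
    simp only [Pi.mul_apply, hUR, iU]; simp
  have hprod := (indepFun_iff_map_prod_eq_prod_map_map mU mR).1 hind
  rw [hvU, hvR] at hprod
  set S : Set (ℝ × ℝ) := {p | |p.1| ≤ ε ∧ |p.2 + ρ * p.1| ≤ ε} with hS
  have hSm : MeasurableSet S := by
    have e1 : MeasurableSet {p : ℝ × ℝ | |p.1| ≤ ε} :=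
      measurableSet_le (by fun_prop) measurable_const
    have e2 : MeasurableSet {p : ℝ × ℝ | |p.2 + ρ * p.1| ≤ ε} :=
      measurableSet_le (by fun_prop) measurable_const
    exact e1.inter e2
  have h1 : P {ω | |U ω| ≤ ε ∧ |V ω| ≤ ε} = (gaussianReal 0 vU).prod (gaussianReal 0 vR) S := by
    rw [← hprod, Measure.map_apply_of_aemeasurable (mU.prodMk mR) hSm]
    congr 1; ext ω; simp [hS, hR]
  rw [h1, Measure.prod_apply hSm]
  have h2 : ∀ u, gaussianReal 0 vR (Prod.mk u ⁻¹' S) ≤ (Icc (-ε) ε).indicator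
      (fun _ => ENNReal.ofReal (2 * ε) * ENNReal.ofReal (Real.sqrt vR)⁻¹) u := by
    intro u
    by_cases hu : u ∈ Icc (-ε) ε
    · rw [indicator_of_mem hu]
      have : Prod.mk u ⁻¹' S ⊆ Icc (-ε - ρ * u) (ε - ρ * u) := by
        intro r hr
        have := abs_le.1 hr.2
        simp only at this
        constructor <;> linarith [this.1, this.2]
      refine (measure_mono this).trans ((aux_gauss_Icc vR hvR0 _ _).trans ?_)
      apply le_of_eq; congr 2; ring
    · rw [indicator_of_notMem hu]
      have : Prod.mk u ⁻¹' S = ∅ := by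
        ext r
        simp only [hS, mem_preimage, mem_ofPred_eq, mem_empty_iff_false, iff_false, not_and]
        intro h; exact absurd (abs_le.1 h) hu
      rw [this]; simp
  refine (lintegral_mono h2).trans ?_
  rw [lintegral_indicator measurableSet_Icc, setLIntegral_const]
  have h3 : Real.sqrt (A * B - C ^ 2) = Real.sqrt vR * Real.sqrt vU := by
    rw [← Real.sqrt_mul (by positivity), hRR, hvUA]; congr 1; field_simp
  rw [h3, mul_inv, ENNReal.ofReal_mul (p := (Real.sqrt vR)⁻¹) (by positivity)]
  calc _ ≤ ENNReal.ofReal (2 * ε) * ENNReal.ofReal (Real.sqrt vR)⁻¹ *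
        (ENNReal.ofReal (ε - -ε) * ENNReal.ofReal (Real.sqrt vU)⁻¹) := by
        gcongr; exact aux_gauss_Icc vU hvU0 _ _
    _ = _ := by rw [show ε - -ε = 2 * ε by ring]; ring

lemma aux_log_bound {y e : ℝ} (hy : 0 < y) (he : 0 < e) :
    |Real.log y| ≤ (y ^ e + y ^ (-e)) / e := by
  have h1 := Real.log_le_rpow_div hy.le he
  have h2 := Real.log_le_rpow_div (inv_pos.2 hy).le he
  rw [Real.log_inv, Real.inv_rpow hy.le, ← Real.rpow_neg hy.le] at h2
  have p1 : 0 < y ^ e / e := by positivity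
  have p2 : 0 < y ^ (-e) / e := by positivity
  rw [add_div, abs_le]
  constructor <;> linarith

lemma aux_logKernel_measurable (h : ℝ) : Measurable (logKernel h) := by
  unfold logKernel
  refine Measurable.ite measurableSet_Ioi ?_ measurable_const
  exact (measurable_id.pow_const _).mul Real.measurable_log

lemma aux_memLp_local {h : ℝ} (h0 : 0 < h) (R : ℝ) (hR : 0 < R) :
    MemLp ((Iic R).indicator (logKernel h)) 2 volume := by
  rw [memLp_indicator_iff_restrict measurableSet_Iic]
  rw [memLp_two_iff_integrable_sq (aux_logKernel_measurable h).aestronglyMeasurable]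
  change IntegrableOn _ _ _
  rw [← Iic_union_Ioc_eq_Iic hR.le]
  refine IntegrableOn.union ?_ ?_
  · refine (integrableOn_zero (ε' := ℝ)).congr_fun (fun x hx => ?_) measurableSet_Iic
    have : ¬ 0 < x := not_lt.2 hx
    simp [logKernel, this]
  · have i1 : IntegrableOn (fun y : ℝ => y ^ (3 * h - 1)) (Ioc 0 R) :=
      (intervalIntegrable_iff_integrableOn_Ioc_of_le hR.le).1
        (intervalIntegral.intervalIntegrable_rpow' (by linarith))
    have i2 : IntegrableOn (fun y : ℝ => y ^ (h - 1)) (Ioc 0 R) :=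
      (intervalIntegrable_iff_integrableOn_Ioc_of_le hR.le).1
        (intervalIntegral.intervalIntegrable_rpow' (by linarith))
    refine Integrable.mono' ((i1.add i2).const_mul (8 / h ^ 2))
      ((aux_logKernel_measurable h).pow_const 2).aestronglyMeasurable ?_
    refine (ae_restrict_mem measurableSet_Ioc).mono fun y hy => ?_
    have hy0 : 0 < y := hy.1
    simp only [logKernel, if_pos hy0, Pi.add_apply, Real.norm_eq_abs]
    rw [abs_of_nonneg (sq_nonneg _), mul_pow, ← sq_abs (Real.log y)]
    have hb := aux_log_bound hy0 (e := h / 2) (by linarith)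
    calc (y ^ (h - 1/2)) ^ 2 * |Real.log y| ^ 2
        ≤ (y ^ (h - 1/2)) ^ 2 * ((y ^ (h/2) + y ^ (-(h/2))) / (h / 2)) ^ 2 := by gcongr
      _ ≤ (y ^ (h - 1/2)) ^ 2 * (8 / h ^ 2 * ((y ^ (h/2)) ^ 2 + (y ^ (-(h/2))) ^ 2)) := by
          gcongr
          rw [div_pow, div_pow, div_le_iff₀ (by positivity)]
          have : 8 / h ^ 2 * ((y ^ (h/2)) ^ 2 + (y ^ (-(h/2))) ^ 2) * (h ^ 2 / 2 ^ 2)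
            = 2 * ((y ^ (h/2)) ^ 2 + (y ^ (-(h/2))) ^ 2) := by field_simp; ring
          rw [this]
          nlinarith [sq_nonneg (y ^ (h/2) - y ^ (-(h/2)))]
      _ = 8 / h ^ 2 * (y ^ (3 * h - 1) + y ^ (h - 1)) := by
          have e1 : y ^ (3 * h - 1) = (y ^ (h - 1/2)) ^ 2 * (y ^ (h/2)) ^ 2 := by
            rw [← Real.rpow_natCast, ← Real.rpow_natCast, ← Real.rpow_mul hy0.le,
              ← Real.rpow_mul hy0.le, ← Real.rpow_add hy0]
            congr 1; push_cast; ring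
          have e2 : y ^ (h - 1) = (y ^ (h - 1/2)) ^ 2 * (y ^ (-(h/2))) ^ 2 := by
            rw [← Real.rpow_natCast, ← Real.rpow_natCast, ← Real.rpow_mul hy0.le,
              ← Real.rpow_mul hy0.le, ← Real.rpow_add hy0]
            congr 1; push_cast; ring
          rw [e1, e2]; ring

lemma aux_tail_bound {h : ℝ} (h0 : 0 < h) (h1 : h < 1) {s : ℝ} (hs : 0 < s) {u : ℝ} (hu : 1 < u) :
    |logKernel h (s + u) - logKernel h u| ≤
      (1 + 4 / (1 - h)) * s * u ^ (h - 3/2 + (1 - h) / 4) := by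
  have hu0 : 0 < u := by linarith
  set e := (1 - h) / 4 with he
  have he0 : 0 < e := by rw [he]; linarith
  have hd : ∀ y ∈ Icc u (s + u), HasDerivWithinAt (fun y : ℝ => y ^ (h - 1/2) * Real.log y)
      ((h - 1/2) * y ^ (h - 1/2 - 1) * Real.log y + y ^ (h - 1/2) * y⁻¹) (Icc u (s + u)) y := by
    intro y hy
    have hy0 : y ≠ 0 := by have := hy.1; linarith
    exact ((Real.hasDerivAt_rpow_const (Or.inl hy0)).mul (Real.hasDerivAt_log hy0)).hasDerivWithinAt
  have hbd : ∀ y ∈ Icc u (s + u),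
      ‖(h - 1/2) * y ^ (h - 1/2 - 1) * Real.log y + y ^ (h - 1/2) * y⁻¹‖ ≤
      (1 + 4 / (1 - h)) * u ^ (h - 3/2 + e) := by
    intro y hy
    have hy0 : 0 < y := by linarith [hy.1]
    have hy1 : 1 ≤ y := by linarith [hy.1]
    have e1 : y ^ (h - 1/2) * y⁻¹ = y ^ (h - 3/2) := by
      rw [← Real.rpow_neg_one y, ← Real.rpow_add hy0]; congr 1; ring
    have e2 : h - 1/2 - 1 = h - 3/2 := by ring
    rw [e1, e2, Real.norm_eq_abs]
    have hl0 : 0 ≤ Real.log y := Real.log_nonneg hy1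
    have hl1 : Real.log y ≤ y ^ e / e := Real.log_le_rpow_div hy0.le he0
    have hy2 : 1 ≤ y ^ e := Real.one_le_rpow hy1 he0.le
    have hp : 0 < y ^ (h - 3/2) := by positivity
    have h5 : |h - 1/2| ≤ 1 := by rw [abs_le]; constructor <;> linarith
    calc |(h - 1/2) * y ^ (h - 3/2) * Real.log y + y ^ (h - 3/2)|
        ≤ |(h - 1/2) * y ^ (h - 3/2) * Real.log y| + |y ^ (h - 3/2)| := abs_add_le _ _
      _ = |h - 1/2| * y ^ (h - 3/2) * Real.log y + y ^ (h - 3/2) := by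
          rw [abs_mul, abs_mul, abs_of_pos hp, abs_of_nonneg hl0]
      _ ≤ 1 * y ^ (h - 3/2) * (y ^ e / e) + y ^ (h - 3/2) * y ^ e := by
          gcongr
          exact le_mul_of_one_le_right hp.le hy2
      _ = (1 + 1 / e) * y ^ (h - 3/2 + e) := by
          rw [Real.rpow_add hy0]; field_simp; ring
      _ ≤ (1 + 1 / e) * u ^ (h - 3/2 + e) := by
          gcongr (1 + 1 / e) * ?_
          exact Real.rpow_le_rpow_of_nonpos hu0 hy.1 (by rw [he]; linarith)
      _ = _ := by rw [he]; congr 2; field_simp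
  have := norm_image_sub_le_of_norm_deriv_le_segment' hd (fun y hy => hbd y ⟨hy.1, hy.2.le⟩)
    (s + u) ⟨by linarith, le_rfl⟩
  simp only [logKernel, if_pos hu0, if_pos (add_pos hs hu0)]
  rw [Real.norm_eq_abs] at this
  refine this.trans (le_of_eq ?_)
  ring

lemma aux_memLp {h : ℝ} (h0 : 0 < h) (h1 : h < 1) {s : ℝ} (hs : 0 < s) :
    MemLp (fun x => logKernel h (s - x) - logKernel h (-x)) 2 volume := by
  set g := fun x => logKernel h (s - x) - logKernel h (-x) with hg
  have hgm : Measurable g :=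
    ((aux_logKernel_measurable h).comp (measurable_const.sub measurable_id)).sub
      ((aux_logKernel_measurable h).comp measurable_neg)
  set F := (Iic (s + 1)).indicator (logKernel h) with hF
  have hFL : MemLp F 2 volume := aux_memLp_local h0 (s + 1) (by linarith)
  have hF1 : MemLp (fun x => F (s - x)) 2 volume :=
    hFL.comp_measurePreserving (Measure.measurePreserving_sub_left volume s)
  have hF2 : MemLp (fun x => F (-x)) 2 volume :=
    hFL.comp_measurePreserving (Measure.measurePreserving_neg volume)
  set p := h - 3/2 + (1 - h) / 4 with hp
  set c := (1 + 4 / (1 - h)) * s with hc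
  set T := (Ioi (1:ℝ)).indicator (fun u : ℝ => c * u ^ p) with hT
  have hTL : MemLp T 2 volume := by
    rw [hT, memLp_indicator_iff_restrict measurableSet_Ioi]
    have hm : Measurable (fun u : ℝ => c * u ^ p) := (measurable_id.pow_const p).const_mul c
    rw [memLp_two_iff_integrable_sq hm.aestronglyMeasurable]
    have i1 : IntegrableOn (fun u : ℝ => u ^ (2 * p)) (Ioi 1) :=
      integrableOn_Ioi_rpow_of_lt (by rw [hp]; linarith) one_pos
    refine IntegrableOn.congr_fun (i1.const_mul (c ^ 2)) (fun u hu => ?_) measurableSet_Ioi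
    have hu0 : 0 < u := lt_trans one_pos hu
    change c ^ 2 * u ^ (2 * p) = (c * u ^ p) ^ 2
    rw [mul_pow c, ← Real.rpow_natCast (u ^ p), ← Real.rpow_mul hu0.le, mul_comm p]
    norm_cast
  have hT1 : MemLp (fun x => T (-x)) 2 volume :=
    hTL.comp_measurePreserving (Measure.measurePreserving_neg volume)
  have hsum : MemLp (fun x => (|F (s - x)| + |F (-x)|) + |T (-x)|) 2 volume :=
    (hF1.abs.add hF2.abs).add hT1.abs
  refine hsum.mono hgm.aestronglyMeasurable (ae_of_all _ fun x => ?_)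
  rw [Real.norm_eq_abs, Real.norm_eq_abs,
    abs_of_nonneg (a := |F (s - x)| + |F (-x)| + |T (-x)|) (by positivity)]
  rcases le_or_gt (-1) x with hx | hx
  · have e1 : F (s - x) = logKernel h (s - x) := indicator_of_mem (by simp; linarith) _
    have e2 : F (-x) = logKernel h (-x) := indicator_of_mem (by simp; linarith) _
    rw [e1, e2]
    have := abs_sub (logKernel h (s - x)) (logKernel h (-x))
    linarith [abs_nonneg (T (-x))]
  · have := aux_tail_bound h0 h1 hs (u := -x) (by linarith)
    have e1 : T (-x) = c * (-x) ^ p := indicator_of_mem (by simp; linarith) _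
    rw [← sub_eq_add_neg, ← hp, ← hc, ← e1] at this
    have h3 : |g x| ≤ T (-x) := this
    linarith [abs_nonneg (F (s - x)), abs_nonneg (F (-x)), le_abs_self (T (-x))]

lemma aux_local_lower {H : ℝ → ℝ} {b θ s t : ℝ} (hb1 : b < 1) (hs : 0 ≤ s) (hst : s < t)
    (hθ : t - s ≤ θ) (hθ1 : θ < 1) (hHb : H t ≤ b) (hL : MemLp (gKer H t) 2 volume) :
    (Real.log θ) ^ 2 / 4 * (t - s) ^ (2 * b) ≤ ∫ x in Ioo s t, gKer H t x * gKer H t x := by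
  have hd : 0 < t - s := by linarith
  have hint : Integrable (fun x => gKer H t x * gKer H t x) volume := hL.integrable_mul hL
  have hsub : Ioo s ((s + t) / 2) ⊆ Ioo s t := Ioo_subset_Ioo_right (by linarith)
  have hpt : ∀ x ∈ Ioo s ((s + t) / 2),
      (Real.log θ) ^ 2 * ((t - s) ^ (2 * b - 1) / 2) ≤ gKer H t x * gKer H t x := by
    intro x hx
    have hx1 := hx.1
    have hx2 := hx.2
    have hy : 0 < t - x := by linarith
    have hy1 : t - x < t - s := by linarith
    have hy2 : (t - s) / 2 ≤ t - x := by linarith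
    have hyθ : t - x ≤ θ := by linarith
    have hy1' : t - x ≤ 1 := by linarith
    have hnx : ¬ (0 < -x) := by linarith
    have e1 : gKer H t x * gKer H t x = (Real.log (t - x)) ^ 2 * (t - x) ^ (2 * H t - 1) := by
      simp only [gKer, logKernel, if_pos hy, if_neg hnx, sub_zero]
      have : (t - x) ^ (2 * H t - 1) = (t - x) ^ (H t - 1/2) * (t - x) ^ (H t - 1/2) := by
        rw [← Real.rpow_add hy]; congr 1; ring
      rw [this]; ring
    rw [e1]
    have hlog : Real.log (t - x) ≤ Real.log θ := Real.log_le_log hy hyθ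
    have hlogn : Real.log θ ≤ 0 := Real.log_nonpos (by linarith) hθ1.le
    have h1 : (Real.log θ) ^ 2 ≤ (Real.log (t - x)) ^ 2 := by nlinarith
    have h2 : (t - s) ^ (2 * b - 1) / 2 ≤ (t - x) ^ (2 * H t - 1) := by
      calc (t - s) ^ (2 * b - 1) / 2 = (t - s) / 2 * (t - s) ^ (2 * b - 2) := by
            rw [show 2 * b - 1 = 1 + (2 * b - 2) by ring, Real.rpow_add hd, Real.rpow_one]; ring
        _ ≤ (t - x) * (t - x) ^ (2 * b - 2) := by
            gcongr ?_ * ?_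
            exact Real.rpow_le_rpow_of_nonpos hy hy1.le (by linarith)
        _ = (t - x) ^ (2 * b - 1) := by
            rw [show 2 * b - 1 = 1 + (2 * b - 2) by ring, Real.rpow_add hy, Real.rpow_one]
        _ ≤ _ := Real.rpow_le_rpow_of_exponent_ge hy hy1' (by linarith)
    gcongr
  calc (Real.log θ) ^ 2 / 4 * (t - s) ^ (2 * b)
      = ∫ x in Ioo s ((s + t) / 2), (Real.log θ) ^ 2 * ((t - s) ^ (2 * b - 1) / 2) := by
        rw [setIntegral_const, Real.volume_real_Ioo_of_le (by linarith), smul_eq_mul,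
          show 2 * b = 1 + (2 * b - 1) by ring, Real.rpow_add hd, Real.rpow_one]
        ring_nf
    _ ≤ ∫ x in Ioo s ((s + t) / 2), gKer H t x * gKer H t x :=
        setIntegral_mono_on (integrableOn_const (by simp)) hint.integrableOn measurableSet_Ioo hpt
    _ ≤ _ := setIntegral_mono_set hint.integrableOn
        (ae_of_all _ fun x => mul_self_nonneg _) hsub.eventuallyLE

lemma aux_det {H : ℝ → ℝ} {s t : ℝ} (hs : 0 ≤ s)
    (hLs : MemLp (gKer H s) 2 volume) (hLt : MemLp (gKer H t) 2 volume)
    (A B C : ℝ) (hA : ∫ x, gKer H s x * gKer H s x = A) (hB : ∫ x, gKer H t x * gKer H t x = B)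
    (hC : ∫ x, gKer H s x * gKer H t x = C) (hA0 : 0 < A) :
    A * ∫ x in Ioo s t, gKer H t x * gKer H t x ≤ A * B - C ^ 2 := by
  set l := C / A with hl
  have iss : Integrable (fun x => gKer H s x * gKer H s x) volume := hLs.integrable_mul hLs
  have ist : Integrable (fun x => gKer H s x * gKer H t x) volume := hLs.integrable_mul hLt
  have itt : Integrable (fun x => gKer H t x * gKer H t x) volume := hLt.integrable_mul hLt
  have i1 : Integrable (fun x => gKer H t x * gKer H t x - 2 * l * (gKer H s x * gKer H t x))
    volume := itt.sub (ist.const_mul _)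
  have e : (fun x => (gKer H t x - l * gKer H s x) ^ 2) = fun x =>
      gKer H t x * gKer H t x - 2 * l * (gKer H s x * gKer H t x)
        + l ^ 2 * (gKer H s x * gKer H s x) := by
    ext x; ring
  have i2 : Integrable (fun x => (gKer H t x - l * gKer H s x) ^ 2) volume := by
    rw [e]; exact i1.add (iss.const_mul _)
  have h1 : ∫ x, (gKer H t x - l * gKer H s x) ^ 2 = B - C ^ 2 / A := by
    rw [e, integral_add i1 (iss.const_mul _), integral_sub itt (ist.const_mul _),
      integral_const_mul, integral_const_mul, hA, hB, hC, hl]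
    field_simp; ring
  have h2 : ∫ x in Ioo s t, gKer H t x * gKer H t x =
      ∫ x in Ioo s t, (gKer H t x - l * gKer H s x) ^ 2 := by
    refine setIntegral_congr_fun measurableSet_Ioo fun x hx => ?_
    have hx1 : ¬ (0 < s - x) := by have := hx.1; linarith
    have hx2 : ¬ (0 < -x) := by have := hx.1; linarith
    have : gKer H s x = 0 := by
      simp only [gKer, logKernel, if_neg hx1, if_neg hx2, sub_zero]
    simp only [this]; ring
  have h3 : ∫ x in Ioo s t, (gKer H t x - l * gKer H s x) ^ 2 ≤ B - C ^ 2 / A := by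
    rw [← h1]
    exact setIntegral_le_integral i2 (ae_of_all _ fun x => sq_nonneg _)
  rw [h2]
  calc _ ≤ A * (B - C ^ 2 / A) := by gcongr
    _ = _ := by field_simp

/-- Uniform lower bounds on the variances and on the two-point determinant. -/
lemma aux_det_lower {δ₁ δ₂ : ℝ} (h₁ : 0 < δ₁) (h₂ : δ₁ < δ₂) (h₃ : δ₂ - δ₁ < 1)
    {H : ℝ → ℝ} (hHrange : ∀ s ∈ Set.Icc δ₁ δ₂, H s ∈ Set.Ioo (0:ℝ) 1)
    {b : ℝ} (hb1 : b < 1) (hHb : ∀ s ∈ Icc δ₁ δ₂, H s ≤ b) :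
    ∃ c > 0, ∀ s ∈ Icc δ₁ δ₂, 0 < (∫ x, gKer H s x * gKer H s x) ∧ ∀ t ∈ Icc δ₁ δ₂, s < t →
      c * (t - s) ^ (2 * b) ≤ (∫ x, gKer H s x * gKer H s x) * (∫ x, gKer H t x * gKer H t x)
        - (∫ x, gKer H s x * gKer H t x) ^ 2 := by
  set θ := δ₂ - δ₁ with hθ
  have hθ0 : 0 < θ := by rw [hθ]; linarith
  have hlog : Real.log θ < 0 := Real.log_neg hθ0 h₃
  set q := (Real.log θ) ^ 2 / 4 with hq
  have hq0 : 0 < q := by have := hlog.ne; positivity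
  set r := min δ₁ θ with hr
  have hr0 : 0 < r := lt_min h₁ hθ0
  have hL : ∀ s ∈ Icc δ₁ δ₂, MemLp (gKer H s) 2 volume := fun s hs =>
    aux_memLp (hHrange s hs).1 (hHrange s hs).2 (h₁.trans_le hs.1)
  have hA : ∀ s ∈ Icc δ₁ δ₂, q * r ^ (2 * b) ≤ ∫ x, gKer H s x * gKer H s x := by
    intro s hs
    have h5 := aux_local_lower (s := s - r) hb1
      (by have := min_le_left δ₁ θ; linarith [hs.1]) (by linarith)
      (by have := min_le_right δ₁ θ; linarith) h₃ (hHb s hs) (hL s hs)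
    rw [sub_sub_cancel] at h5
    exact h5.trans (setIntegral_le_integral ((hL s hs).integrable_mul (hL s hs))
      (ae_of_all _ fun x => mul_self_nonneg _))
  have hpos : 0 < q * r ^ (2 * b) := by positivity
  refine ⟨q * r ^ (2 * b) * q, by positivity, fun s hs => ⟨hpos.trans_le (hA s hs), ?_⟩⟩
  intro t ht hst
  have hs0 : 0 ≤ s := h₁.le.trans hs.1
  refine le_trans ?_ (aux_det hs0 (hL s hs) (hL t ht) _ _ _ rfl rfl rfl (hpos.trans_le (hA s hs)))
  rw [mul_assoc]
  have hd : 0 < t - s := by linarith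
  gcongr
  · exact hpos.le.trans (hA s hs)
  · exact hA s hs
  · exact aux_local_lower hb1 hs0 hst (by linarith [hs.1, ht.2]) h₃ (hHb t ht) (hL t ht)

lemma aux_rpow_neg_mul {x : ℝ≥0∞} (hx : x ≠ ∞) {p q : ℝ} (hp : 0 ≤ p) (hq : 0 ≤ q) :
    x ^ (-p) * x ^ (-q) = x ^ (-(p + q)) := by
  rw [ENNReal.rpow_neg, ENNReal.rpow_neg, ENNReal.rpow_neg,
    ENNReal.rpow_add_of_nonneg _ _ hp hq, ENNReal.mul_inv]
  · exact Or.inr (ENNReal.rpow_ne_top_of_nonneg hq hx)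
  · exact Or.inl (ENNReal.rpow_ne_top_of_nonneg hp hx)

lemma aux_energy_finite (δ₁ δ₂ : ℝ) (h₂ : δ₁ < δ₂) {β : ℝ} (hβ : β < 1) :
    ∫⁻ s in Icc δ₁ δ₂, ∫⁻ t in Icc δ₁ δ₂, edist s t ^ (-β) ≠ ∞ := by
  set θ := δ₂ - δ₁ with hθ
  have hθ0 : 0 < θ := by rw [hθ]; linarith
  set G : ℝ → ℝ≥0∞ := (Ioc 0 θ).indicator (fun u => ENNReal.ofReal (u ^ (-β))) with hG
  have hGm : Measurable G :=
    (ENNReal.measurable_ofReal.comp (measurable_id.pow_const (-β))).indicator measurableSet_Ioc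
  have hGi : ∫⁻ u, G u ≠ ∞ := by
    rw [hG, lintegral_indicator measurableSet_Ioc]
    have i1 : IntegrableOn (fun y : ℝ => y ^ (-β)) (Ioc 0 θ) :=
      (intervalIntegrable_iff_integrableOn_Ioc_of_le hθ0.le).1
        (intervalIntegral.intervalIntegrable_rpow' (by linarith))
    exact i1.lintegral_lt_top.ne
  have hs : ∀ s ∈ Icc δ₁ δ₂, ∫⁻ t in Icc δ₁ δ₂, edist s t ^ (-β) ≤ 2 * ∫⁻ u, G u := by
    intro s hs
    calc ∫⁻ t in Icc δ₁ δ₂, edist s t ^ (-β)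
        ≤ ∫⁻ t in Icc δ₁ δ₂, (G (s - t) + G (t - s)) := by
          refine lintegral_mono_ae ?_
          have hne : ∀ᵐ t ∂(volume.restrict (Icc δ₁ δ₂)), t ≠ s :=
            ae_restrict_of_ae (by simp [ae_iff])
          filter_upwards [hne, ae_restrict_mem measurableSet_Icc] with t hts ht
          have e0 : edist s t ^ (-β) = ENNReal.ofReal (|s - t| ^ (-β)) := by
            rw [edist_dist, Real.dist_eq, ENNReal.ofReal_rpow_of_pos]
            exact abs_pos.2 (sub_ne_zero.2 hts.symm)
          rcases lt_or_gt_of_ne hts with h | h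
          · refine le_trans ?_ le_self_add
            have : s - t ∈ Ioc 0 θ := ⟨by linarith, by linarith [hs.2, ht.1]⟩
            rw [hG, indicator_of_mem this, e0, abs_of_pos this.1]
          · refine le_trans ?_ le_add_self
            have : t - s ∈ Ioc 0 θ := ⟨by linarith, by linarith [hs.1, ht.2]⟩
            rw [hG, indicator_of_mem this, e0, abs_sub_comm, abs_of_pos this.1]
      _ ≤ ∫⁻ t, (G (s - t) + G (t - s)) := setLIntegral_le_lintegral _ _
      _ = _ := by
          have hm2 : Measurable fun t => G (t - s) := hGm.comp (measurable_id.sub_const s)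
          rw [lintegral_add_right _ hm2,
            lintegral_sub_left_eq_self (fun u => G u) s,
            lintegral_sub_right_eq_self (fun u => G u) s]
          ring
  have : ∫⁻ s in Icc δ₁ δ₂, ∫⁻ t in Icc δ₁ δ₂, edist s t ^ (-β) ≤
      ∫⁻ s in Icc δ₁ δ₂, 2 * ∫⁻ u, G u := setLIntegral_mono' measurableSet_Icc hs
  refine ne_top_of_le_ne_top ?_ this
  rw [setLIntegral_const]
  exact ENNReal.mul_ne_top (ENNReal.mul_ne_top (by simp) hGi) (by simp)

lemma aux_version {Ω : Type*} [MeasurableSpace Ω] (P : Measure Ω) {δ₁ δ₂ : ℝ} (h₂ : δ₁ < δ₂)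
    (Y : ℝ → Ω → ℝ) (hY : ∀ s ∈ Icc δ₁ δ₂, AEMeasurable (Y s) P)
    (hcont : ∀ᵐ ω ∂P, ContinuousOn (fun s => Y s ω) (Set.Icc δ₁ δ₂)) :
    ∃ Z : ℝ → Ω → ℝ, (∀ ω, Continuous fun s => Z s ω) ∧ (∀ s, Measurable (Z s)) ∧
      ∀ᵐ ω ∂P, ∀ s ∈ Icc δ₁ δ₂, Z s ω = Y s ω := by
  have : Nonempty (Icc δ₁ δ₂) := ⟨⟨δ₁, le_rfl, h₂.le⟩⟩
  set d := TopologicalSpace.denseSeq (Icc δ₁ δ₂) with hd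
  have hdd : DenseRange d := TopologicalSpace.denseRange_denseSeq _
  have hae : ∀ᵐ ω ∂P, ContinuousOn (fun s => Y s ω) (Set.Icc δ₁ δ₂) ∧
      ∀ n, Y (d n) ω = (hY (d n) (d n).2).mk _ ω := by
    refine hcont.and (ae_all_iff.2 fun n => (hY (d n) (d n).2).ae_eq_mk)
  obtain ⟨N, hNsub, hNm, hN0⟩ := exists_measurable_superset_of_null (ae_iff.1 hae)
  have hgood : ∀ ω ∈ Nᶜ, ContinuousOn (fun s => Y s ω) (Set.Icc δ₁ δ₂) ∧
      ∀ n, Y (d n) ω = (hY (d n) (d n).2).mk _ ω := by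
    intro ω hω
    by_contra hcon
    exact hω (hNsub hcon)
  set Z : ℝ → Ω → ℝ := fun s => Nᶜ.indicator (Y (projIcc δ₁ δ₂ h₂.le s)) with hZ
  have hZc : ∀ ω, Continuous fun s => Z s ω := by
    intro ω
    by_cases hω : ω ∈ Nᶜ
    · simp only [hZ, indicator_of_mem hω]
      exact (continuousOn_iff_continuous_domRestrict.1 (hgood ω hω).1).comp continuous_projIcc
    · simp only [hZ, indicator_of_notMem hω]
      exact continuous_const
  have hZd : ∀ n, Measurable (Z (d n)) := by
    intro n
    have : Z (d n) = Nᶜ.indicator ((hY (d n) (d n).2).mk _) := by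
      ext ω
      by_cases hω : ω ∈ Nᶜ
      · simp only [hZ, indicator_of_mem hω, projIcc_val]
        exact (hgood ω hω).2 n
      · simp only [hZ, indicator_of_notMem hω]
    rw [this]
    exact (hY (d n) (d n).2).measurable_mk.indicator hNm.compl
  have hZp : ∀ s, Z s = Z (projIcc δ₁ δ₂ h₂.le s) := by
    intro s; simp only [hZ, projIcc_val]
  refine ⟨Z, hZc, fun s => ?_, ?_⟩
  · rw [hZp s]
    obtain ⟨x, hx, hxl⟩ := mem_closure_iff_seq_limit.1 (hdd (projIcc δ₁ δ₂ h₂.le s))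
    refine measurable_of_tendsto_metrizable (f := fun n => Z (x n)) (fun n => ?_) ?_
    · obtain ⟨k, hk⟩ := hx n
      rw [← hk]; exact hZd k
    · rw [tendsto_pi_nhds]
      intro ω
      exact ((hZc ω).tendsto _).comp ((continuous_subtype_val.tendsto _).comp hxl)
  · have : ∀ᵐ ω ∂P, ω ∈ Nᶜ := by rw [ae_iff]; simpa using hN0
    filter_upwards [this] with ω hω s hs
    simp only [hZ, indicator_of_mem hω, projIcc_of_mem h₂.le hs]

set_option maxHeartbeats 1000000 in
lemma aux_core {Ω : Type*} [MeasurableSpace Ω] (P : Measure Ω) [IsProbabilityMeasure P]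
    {δ₁ δ₂ : ℝ} (h₂ : δ₁ < δ₂) {b : ℝ} (hb0 : 0 < b) (hb1 : b < 1)
    (Z : ℝ → Ω → ℝ) (hZc : ∀ ω, Continuous fun s => Z s ω) (hZm : ∀ s, Measurable (Z s))
    (C : ℝ≥0∞) (hC : C ≠ ∞)
    (htwo : ∀ s ∈ Icc δ₁ δ₂, ∀ t ∈ Icc δ₁ δ₂, ∀ ε : ℝ, 0 < ε →
      P {ω | |Z s ω| ≤ ε ∧ |Z t ω| ≤ ε} ≤
        ENNReal.ofReal (2 * ε) * ENNReal.ofReal (2 * ε) * (C * edist s t ^ (-b)))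
    (hone : ∀ s ∈ Icc δ₁ δ₂, ∃ p : ℝ≥0∞, p ≠ 0 ∧ ∀ ε : ℝ, 0 < ε → ε ≤ 1 →
      ENNReal.ofReal (2 * ε) * p ≤ P {ω | |Z s ω| ≤ ε}) :
    ∃ D : Set Ω, 0 < P D ∧ ∀ ω ∈ D,
      ENNReal.ofReal (1 - b) ≤ dimH {s ∈ Set.Icc δ₁ δ₂ | Z s ω = 0} := by
  set lam : Measure ℝ := volume.restrict (Icc δ₁ δ₂) with hlam
  -- the exponents
  set γ : ℕ → ℝ := fun k => (1 - b) * (1 - 1 / ((k : ℝ) + 2)) with hγ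
  have hk2 : ∀ k : ℕ, 0 < 1 / ((k : ℝ) + 2) ∧ 1 / ((k : ℝ) + 2) < 1 := fun k =>
    ⟨by positivity, by rw [div_lt_one (by positivity)]; linarith [k.cast_nonneg (α := ℝ)]⟩
  have hγ0 : ∀ k, 0 < γ k := fun k => mul_pos (by linarith) (by linarith [(hk2 k).2])
  have hγ1 : ∀ k, γ k + b < 1 := by
    intro k
    have := (hk2 k).1
    simp only [hγ]
    nlinarith
  have hγlim : Tendsto γ atTop (𝓝 (1 - b)) := by
    have h1 : Tendsto (fun k : ℕ => 1 / ((k : ℝ) + 2)) atTop (𝓝 0) := by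
      refine tendsto_const_nhds.div_atTop ?_
      exact tendsto_atTop_add_const_right _ _ tendsto_natCast_atTop_atTop
    have h2 := (h1.const_sub 1).const_mul (1 - b)
    rw [sub_zero, mul_one] at h2
    exact h2
  -- the weights
  set J : ℕ → ℝ≥0∞ := fun k => ∫⁻ s, ∫⁻ t, edist s t ^ (-(γ k + b)) ∂lam ∂lam with hJ
  have hJfin : ∀ k, J k ≠ ∞ := fun k => aux_energy_finite δ₁ δ₂ h₂ (hγ1 k)
  obtain ⟨w, hw0, hwsum⟩ := ENNReal.exists_pos_tsum_mul_lt_of_countable one_ne_zero J hJfin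
  obtain ⟨Φ, hΦ⟩ : ∃ Φ : ℝ → ℝ → ℝ≥0∞,
      ∀ s t, Φ s t = 1 + ∑' k, (w k : ℝ≥0∞) * edist s t ^ (-γ k) := ⟨_, fun _ _ => rfl⟩
  have hed : ∀ r : ℝ, Measurable fun p : ℝ × ℝ => edist p.1 p.2 ^ r := fun r =>
    measurable_edist.pow_const r
  have hΦm : Measurable fun p : ℝ × ℝ => Φ p.1 p.2 := by
    simp only [hΦ]
    exact measurable_const.add (Measurable.tsum fun k => (hed _).const_mul _)
  -- the densities
  set ε : ℕ → ℝ := fun n => 1 / ((n : ℝ) + 1) with hε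
  have hε0 : ∀ n, 0 < ε n := fun n => by positivity
  have hε1 : ∀ n, ε n ≤ 1 := fun n => by
    simp only [hε]; rw [div_le_one (by positivity)]; linarith [n.cast_nonneg (α := ℝ)]
  set c : ℕ → ℝ≥0∞ := fun n => (ENNReal.ofReal (2 * ε n))⁻¹ with hc
  have hce : ∀ n, c n * ENNReal.ofReal (2 * ε n) = 1 := fun n =>
    ENNReal.inv_mul_cancel (by simpa using hε0 n) ENNReal.ofReal_ne_top
  have hZj : Measurable fun p : ℝ × Ω => Z p.1 p.2 :=
    measurable_uncurry_of_continuous_of_measurable hZc hZm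
  set S : ℕ → Set (ℝ × Ω) := fun n => {p | |Z p.1 p.2| ≤ ε n} with hS
  have hSm : ∀ n, MeasurableSet (S n) := fun n =>
    measurableSet_le (continuous_abs.measurable.comp hZj) measurable_const
  obtain ⟨g, hg⟩ : ∃ g : ℕ → ℝ → Ω → ℝ≥0∞,
      ∀ n s ω, g n s ω = (S n).indicator (fun _ => c n) (s, ω) := ⟨_, fun _ _ _ => rfl⟩
  have hgj : ∀ n, Measurable fun p : ℝ × Ω => g n p.1 p.2 := by
    intro n
    simp only [hg]
    exact measurable_const.indicator (hSm n)
  have hgs : ∀ n ω, Measurable fun s => g n s ω := fun n ω =>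
    (hgj n).comp (measurable_id.prodMk measurable_const)
  have hgω : ∀ n s, Measurable fun ω => g n s ω := fun n s =>
    (hgj n).comp (measurable_const.prodMk measurable_id)
  set X : ℕ → Ω → ℝ≥0∞ := fun n ω => ∫⁻ s, g n s ω ∂lam with hX
  set W : ℕ → Ω → ℝ≥0∞ := fun n ω => ∫⁻ s, ∫⁻ t, g n s ω * g n t ω * Φ s t ∂lam ∂lam with hW
  -- joint measurability of the integrand in W
  have hWj : ∀ n, Measurable fun q : (Ω × ℝ) × ℝ => g n q.1.2 q.1.1 * g n q.2 q.1.1 * Φ q.1.2 q.2 := by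
    intro n
    refine Measurable.mul (Measurable.mul ?_ ?_) ?_
    · exact (hgj n).comp ((measurable_snd.comp measurable_fst).prodMk
        (measurable_fst.comp measurable_fst))
    · exact (hgj n).comp (measurable_snd.prodMk (measurable_fst.comp measurable_fst))
    · exact hΦm.comp ((measurable_snd.comp measurable_fst).prodMk measurable_snd)
  have hWj2 : ∀ n, Measurable fun q : Ω × ℝ =>
      ∫⁻ t, g n q.2 q.1 * g n t q.1 * Φ q.2 t ∂lam := fun n => (hWj n).lintegral_prod_right'
  have hXm : ∀ n, Measurable (X n) := by
    intro n
    have : Measurable fun q : Ω × ℝ => g n q.2 q.1 :=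
      (hgj n).comp (measurable_snd.prodMk measurable_fst)
    exact this.lintegral_prod_right'
  have hWm : ∀ n, Measurable (W n) := fun n => (hWj2 n).lintegral_prod_right'
  have hXW : ∀ n ω, X n ω * X n ω ≤ W n ω := by
    intro n ω
    calc X n ω * X n ω = ∫⁻ s, ∫⁻ t, g n s ω * g n t ω ∂lam ∂lam := by
          simp_rw [lintegral_const_mul _ (hgs n ω)]
          rw [lintegral_mul_const _ (hgs n ω)]
      _ ≤ W n ω := by
          refine lintegral_mono fun s => lintegral_mono fun t => ?_
          exact le_mul_of_one_le_right zero_le (by rw [hΦ]; exact le_self_add)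
  -- first moment
  set M : ℕ → ℝ → ℝ≥0∞ := fun n s => ∫⁻ ω, g n s ω ∂P with hM
  have hMm : ∀ n, Measurable (M n) := fun n => (hgj n).lintegral_prod_right'
  have hMP : ∀ n s, M n s = c n * P {ω | |Z s ω| ≤ ε n} := by
    intro n s
    have hm : MeasurableSet {ω | |Z s ω| ≤ ε n} :=
      measurableSet_le (continuous_abs.measurable.comp (hZm s)) measurable_const
    have : ∀ ω, g n s ω = {ω | |Z s ω| ≤ ε n}.indicator (fun _ => c n) ω := by
      intro ω
      simp only [hg, indicator, hS, mem_ofPred_eq]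
    simp only [hM]
    simp_rw [this]
    rw [lintegral_indicator hm, setLIntegral_const]
  have hm_pos : (∫⁻ s, ⨅ n, M n s ∂lam) ≠ 0 := by
    intro h0
    rw [lintegral_eq_zero_iff (Measurable.iInf hMm)] at h0
    have : ∀ᵐ s ∂lam, False := by
      filter_upwards [h0, ae_restrict_mem measurableSet_Icc] with s hs hsI
      obtain ⟨p, hp0, hp⟩ := hone s hsI
      have : p ≤ ⨅ n, M n s := by
        refine le_iInf fun n => ?_
        rw [hMP]
        calc p = c n * (ENNReal.ofReal (2 * ε n) * p) := by rw [← mul_assoc, hce, one_mul]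
          _ ≤ _ := by gcongr; exact hp _ (hε0 n) (hε1 n)
      rw [hs] at this
      exact hp0 (le_antisymm this zero_le)
    rw [ae_iff] at this
    simp only [not_false_eq_true, hlam] at this
    have h9 : volume (Icc δ₁ δ₂) = 0 := by simpa using this
    rw [Real.volume_Icc, ENNReal.ofReal_eq_zero] at h9
    linarith
  have hXm1 : ∀ n, (∫⁻ s, ⨅ n, M n s ∂lam) ≤ ∫⁻ ω, X n ω ∂P := by
    intro n
    have : ∫⁻ ω, X n ω ∂P = ∫⁻ s, M n s ∂lam := by
      simp only [hX, hM]
      rw [lintegral_lintegral_swap]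
      exact ((hgj n).comp (measurable_snd.prodMk measurable_fst)).aemeasurable
    rw [this]
    exact lintegral_mono fun s => iInf_le _ n
  -- second moment
  set J0 : ℝ≥0∞ := ∫⁻ s, ∫⁻ t, edist s t ^ (-b) ∂lam ∂lam with hJ0
  have hJ0fin : J0 ≠ ∞ := aux_energy_finite δ₁ δ₂ h₂ hb1
  have hbound : ∫⁻ s, ∫⁻ t, C * edist s t ^ (-b) * Φ s t ∂lam ∂lam ≤ C * (J0 + 1) := by
    have e1 : ∀ s t, C * edist s t ^ (-b) * Φ s t = C * (edist s t ^ (-b) +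
        ∑' k, (w k : ℝ≥0∞) * edist s t ^ (-(γ k + b))) := by
      intro s t
      rw [mul_assoc]
      simp only [hΦ]
      rw [mul_add, mul_one, ← ENNReal.tsum_mul_left]
      congr 2
      refine tsum_congr fun k => ?_
      rw [← aux_rpow_neg_mul (edist_ne_top s t) (hγ0 k).le hb0.le]
      ring
    have m1 : ∀ r : ℝ, ∀ s : ℝ, Measurable fun t : ℝ => edist s t ^ r := fun r s =>
      (hed r).comp (measurable_const.prodMk measurable_id)
    have m2 : ∀ r : ℝ, Measurable fun s : ℝ => ∫⁻ t, edist s t ^ r ∂lam := fun r =>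
      (hed r).lintegral_prod_right'
    have e2 : ∀ s, ∫⁻ t, C * edist s t ^ (-b) * Φ s t ∂lam = C * (∫⁻ t, edist s t ^ (-b) ∂lam +
        ∑' k, (w k : ℝ≥0∞) * ∫⁻ t, edist s t ^ (-(γ k + b)) ∂lam) := by
      intro s
      simp_rw [e1]
      rw [lintegral_const_mul, lintegral_add_left (m1 _ s), lintegral_tsum]
      · congr 2
        exact tsum_congr fun k => lintegral_const_mul _ (m1 _ s)
      · exact fun k => ((m1 _ s).const_mul _).aemeasurable
      · exact (m1 _ s).add (Measurable.tsum fun k => (m1 _ s).const_mul _)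
    simp_rw [e2]
    rw [lintegral_const_mul, lintegral_add_left (m2 _), lintegral_tsum]
    · gcongr
      refine le_trans (le_of_eq ?_) hwsum.le
      refine tsum_congr fun k => ?_
      rw [lintegral_const_mul _ (m2 _), mul_comm]
    · exact fun k => ((m2 _).const_mul _).aemeasurable
    · exact (m2 _).add (Measurable.tsum fun k => (m2 _).const_mul _)
  have hWC : ∀ n, ∫⁻ ω, W n ω ∂P ≤ C * (J0 + 1) := by
    intro n
    have e1 : ∫⁻ ω, W n ω ∂P = ∫⁻ s, ∫⁻ t, (∫⁻ ω, g n s ω * g n t ω * Φ s t ∂P) ∂lam ∂lam := by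
      simp only [hW]
      rw [lintegral_lintegral_swap (hWj2 n).aemeasurable]
      refine lintegral_congr fun s => ?_
      rw [lintegral_lintegral_swap]
      have : Measurable fun q : Ω × ℝ => g n s q.1 * g n q.2 q.1 * Φ s q.2 :=
        (hWj n).comp ((measurable_fst.prodMk measurable_const).prodMk measurable_snd)
      exact this.aemeasurable
    rw [e1]
    refine le_trans ?_ hbound
    refine setLIntegral_mono' measurableSet_Icc fun s hs => ?_
    refine setLIntegral_mono' measurableSet_Icc fun t ht => ?_
    have hgg : Measurable fun ω => g n s ω * g n t ω := (hgω n s).mul (hgω n t)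
    rw [lintegral_mul_const _ hgg]
    gcongr
    have hm : MeasurableSet {ω | |Z s ω| ≤ ε n ∧ |Z t ω| ≤ ε n} := by
      have a1 : MeasurableSet {ω | |Z s ω| ≤ ε n} :=
        measurableSet_le (continuous_abs.measurable.comp (hZm s)) measurable_const
      have a2 : MeasurableSet {ω | |Z t ω| ≤ ε n} :=
        measurableSet_le (continuous_abs.measurable.comp (hZm t)) measurable_const
      exact a1.inter a2
    have e2 : ∀ ω, g n s ω * g n t ω =
        {ω | |Z s ω| ≤ ε n ∧ |Z t ω| ≤ ε n}.indicator (fun _ => c n * c n) ω := by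
      intro ω
      simp only [hg, indicator, hS, mem_ofPred_eq]
      by_cases a1 : |Z s ω| ≤ ε n <;> by_cases a2 : |Z t ω| ≤ ε n <;> simp [a1, a2]
    simp_rw [e2]
    rw [lintegral_indicator hm, setLIntegral_const]
    calc _ ≤ c n * c n * (ENNReal.ofReal (2 * ε n) * ENNReal.ofReal (2 * ε n) *
          (C * edist s t ^ (-b))) := by gcongr; exact htwo s hs t ht _ (hε0 n)
      _ = (c n * ENNReal.ofReal (2 * ε n)) * (c n * ENNReal.ofReal (2 * ε n)) *
          (C * edist s t ^ (-b)) := by ring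
      _ = _ := by rw [hce]; ring
  obtain ⟨a, K, D, ha, hK, hD, hDω⟩ := aux_second_moment P X W hXm hWm hXW _ _ hm_pos
    (ENNReal.mul_ne_top hC (ENNReal.add_ne_top.2 ⟨hJ0fin, ENNReal.one_ne_top⟩)) hXm1 hWC
  refine ⟨D, hD, fun ω hω => ?_⟩
  have hdim : ∀ k, ENNReal.ofReal (γ k) ≤ dimH {s ∈ Set.Icc δ₁ δ₂ | Z s ω = 0} := by
    intro k
    have hw0' : (w k : ℝ≥0∞) ≠ 0 := by exact_mod_cast (hw0 k).ne'
    have hH : Measure.hausdorffMeasure (γ k) {s ∈ Set.Icc δ₁ δ₂ | Z s ω = 0} ≠ 0 := by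
      refine aux_energy (hγ0 k) _ a ((w k : ℝ≥0∞)⁻¹ * K) ha
        (ENNReal.mul_ne_top (ENNReal.inv_ne_top.2 hw0') hK) ?_
      intro U hU hZU
      -- positivity of |Z| off U
      have hcomp : IsCompact (Icc δ₁ δ₂ \ U) := isCompact_Icc.diff hU
      have hev : ∀ᶠ n in atTop, ∀ s ∈ Icc δ₁ δ₂ \ U, ε n < |Z s ω| := by
        rcases (Icc δ₁ δ₂ \ U).eq_empty_or_nonempty with hemp | hne
        · rw [hemp]; simp
        · obtain ⟨s0, hs0, hmin⟩ := hcomp.exists_isMinOn hne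
            ((hZc ω).abs.continuousOn)
          have hpos : 0 < |Z s0 ω| := by
            refine abs_pos.2 fun h => hs0.2 (hZU ⟨hs0.1, h⟩)
          have hlim : Tendsto ε atTop (𝓝 0) := tendsto_one_div_add_atTop_nhds_zero_nat
          filter_upwards [hlim.eventually (gt_mem_nhds hpos)] with n hn s hs
          exact lt_of_lt_of_le hn (hmin hs)
      obtain ⟨n, ⟨hna, hnK⟩, hn⟩ := ((hDω ω hω).and_eventually hev).exists
      refine ⟨lam.withDensity fun s => g n s ω, ?_, ?_, ?_⟩
      · rw [withDensity_apply _ hU.isClosed_compl.measurableSet, hlam,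
          Measure.restrict_restrict hU.isClosed_compl.measurableSet]
        rw [setLIntegral_congr_fun (g := fun _ => 0)
          (hU.isClosed_compl.measurableSet.inter measurableSet_Icc)]
        · simp
        · intro s hs
          have := hn s ⟨hs.2, hs.1⟩
          simp only [hg]
          refine indicator_of_notMem ?_ _
          exact not_le.2 this
      · rw [withDensity_apply _ MeasurableSet.univ, Measure.restrict_univ]
        exact hna
      · have m1 : ∀ s : ℝ, Measurable fun t : ℝ => edist s t ^ (-γ k) := fun s =>
          (hed _).comp (measurable_const.prodMk measurable_id)
        have m2 : Measurable fun s : ℝ =>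
            ∫⁻ t, edist s t ^ (-γ k) ∂(lam.withDensity fun s => g n s ω) :=
          (hed _).lintegral_prod_right'
        rw [lintegral_withDensity_eq_lintegral_mul _ (hgs n ω) m2]
        simp only [Pi.mul_apply]
        simp_rw [lintegral_withDensity_eq_lintegral_mul _ (hgs n ω) (m1 _)]
        simp only [Pi.mul_apply]
        have hwW : (w k : ℝ≥0∞) * ∫⁻ s, g n s ω * ∫⁻ t, g n t ω * edist s t ^ (-γ k) ∂lam ∂lam
            ≤ W n ω := by
          have m3 : ∀ s, Measurable fun t => g n t ω * edist s t ^ (-γ k) := fun s =>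
            (hgs n ω).mul (m1 s)
          rw [← lintegral_const_mul' _ _ ENNReal.coe_ne_top]
          refine lintegral_mono fun s => ?_
          rw [← lintegral_const_mul _ (m3 s), ← lintegral_const_mul' _ _ ENNReal.coe_ne_top]
          refine lintegral_mono fun t => ?_
          calc (w k : ℝ≥0∞) * (g n s ω * (g n t ω * edist s t ^ (-γ k)))
              = g n s ω * g n t ω * (w k * edist s t ^ (-γ k)) := by ring
            _ ≤ g n s ω * g n t ω * Φ s t := by
                gcongr
                rw [hΦ]
                exact (ENNReal.le_tsum (f := fun k => (w k : ℝ≥0∞) * edist s t ^ (-γ k)) k).trans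
                  le_add_self
        calc _ = (w k : ℝ≥0∞)⁻¹ * ((w k : ℝ≥0∞) *
              ∫⁻ s, g n s ω * ∫⁻ t, g n t ω * edist s t ^ (-γ k) ∂lam ∂lam) := by
              rw [← mul_assoc, ENNReal.inv_mul_cancel hw0' ENNReal.coe_ne_top, one_mul]
          _ ≤ _ := by gcongr; exact hwW.trans hnK
    have := le_dimH_of_hausdorffMeasure_ne_zero (d := (γ k).toNNReal)
      (s := {s ∈ Set.Icc δ₁ δ₂ | Z s ω = 0}) (by rwa [Real.coe_toNNReal _ (hγ0 k).le])
    exact this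
  exact le_of_tendsto' ((ENNReal.continuous_ofReal.tendsto _).comp hγlim) hdim

lemma aux_gauss_lower (v : ℝ≥0) (hv : v ≠ 0) :
    ∃ p : ℝ≥0∞, p ≠ 0 ∧ ∀ ε : ℝ, 0 < ε → ε ≤ 1 →
      ENNReal.ofReal (2 * ε) * p ≤ gaussianReal 0 v (Icc (-ε) ε) := by
  refine ⟨gaussianPDF 0 v 1, (gaussianPDF_pos 0 hv 1).ne', fun ε hε hε1 => ?_⟩
  rw [gaussianReal_apply _ hv]
  calc ENNReal.ofReal (2 * ε) * gaussianPDF 0 v 1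
      = ∫⁻ _ in Icc (-ε) ε, gaussianPDF 0 v 1 := by
        rw [setLIntegral_const, Real.volume_Icc, mul_comm]
        congr 2
        ring
    _ ≤ _ := by
        refine setLIntegral_mono' measurableSet_Icc fun x hx => ?_
        rw [gaussianPDF, gaussianPDF]
        refine ENNReal.ofReal_le_ofReal ?_
        rw [gaussianPDFReal, gaussianPDFReal]
        have hx2 : x ^ 2 ≤ 1 := by nlinarith [hx.1, hx.2]
        have hv' : (0:ℝ) < v := by exact_mod_cast pos_iff_ne_zero.2 hv
        refine mul_le_mul_of_nonneg_left (Real.exp_le_exp.2 ?_) (by positivity)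
        rw [sub_zero, sub_zero]
        exact div_le_div_of_nonneg_right (by linarith) (by positivity)

lemma aux_two_bound {b c s t d : ℝ} (hc : 0 < c) (hst : s < t)
    (hd : c * (t - s) ^ (2 * b) ≤ d) :
    0 < d ∧ ENNReal.ofReal (Real.sqrt d)⁻¹ ≤
      ENNReal.ofReal (Real.sqrt c)⁻¹ * edist s t ^ (-b) := by
  have hts : 0 < t - s := by linarith
  have hp : 0 < c * (t - s) ^ (2 * b) := by positivity
  refine ⟨hp.trans_le hd, ?_⟩
  have e : edist s t = ENNReal.ofReal (t - s) := by
    rw [edist_comm, edist_dist, Real.dist_eq, abs_of_pos hts]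
  rw [e, ENNReal.ofReal_rpow_of_pos hts, ← ENNReal.ofReal_mul (by positivity)]
  refine ENNReal.ofReal_le_ofReal ?_
  have h1 : Real.sqrt (c * (t - s) ^ (2 * b)) = Real.sqrt c * (t - s) ^ b := by
    rw [Real.sqrt_mul hc.le, mul_comm 2 b, Real.rpow_mul hts.le]
    congr 1
    rw [Real.rpow_two, Real.sqrt_sq (by positivity)]
  calc (Real.sqrt d)⁻¹ ≤ (Real.sqrt (c * (t - s) ^ (2 * b)))⁻¹ := by
        gcongr
    _ = _ := by rw [h1, mul_inv, Real.rpow_neg hts.le]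

/-- Part (iv) of the paper's main theorem, abstract form: for a centered Gaussian
process `Y` on `I = [δ₁,δ₂]` with a.s. continuous paths and covariance
`E[Y(s)Y(t)] = ∫ g_s g_t`, there is an event of positive probability on which the
zero set `{s ∈ I : Y(s,ω) = 0}` has Hausdorff dimension at least `1 − b`, where
`b = max_{s∈I} H(s)`. -/
theorem zero_level_set_dimH_ge
    {Ω : Type*} [MeasurableSpace Ω] (P : Measure Ω) [IsProbabilityMeasure P]
    (δ₁ δ₂ : ℝ) (h₁ : 0 < δ₁) (h₂ : δ₁ < δ₂) (h₃ : δ₂ - δ₁ < 1)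
    (H : ℝ → ℝ) (hHcont : ContinuousOn H (Set.Icc δ₁ δ₂))
    (hHrange : ∀ s ∈ Set.Icc δ₁ δ₂, H s ∈ Set.Ioo (0:ℝ) 1)
    (b : ℝ) (hb : IsGreatest (H '' Set.Icc δ₁ δ₂) b)
    (Y : ℝ → Ω → ℝ)
    (hGauss : ∀ (n : ℕ) (t : Fin n → ℝ), (∀ i, t i ∈ Set.Icc δ₁ δ₂) →
      ∀ c : Fin n → ℝ, ∃ v : NNReal,
        Measure.map (fun ω => ∑ i, c i * Y (t i) ω) P = gaussianReal 0 v)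
    (hcont : ∀ᵐ ω ∂P, ContinuousOn (fun s => Y s ω) (Set.Icc δ₁ δ₂))
    (hcov : ∀ s ∈ Set.Icc δ₁ δ₂, ∀ t ∈ Set.Icc δ₁ δ₂,
      (∫ ω, Y s ω * Y t ω ∂P) = ∫ x : ℝ, gKer H s x * gKer H t x) :
    ∃ D : Set Ω, 0 < P D ∧ ∀ ω ∈ D,
      ENNReal.ofReal (1 - b) ≤ dimH {s ∈ Set.Icc δ₁ δ₂ | Y s ω = 0} := by
  have hb01 : 0 < b ∧ b < 1 := by
    obtain ⟨s0, hs0, hs0b⟩ := hb.1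
    have := hHrange s0 hs0
    rw [hs0b] at this
    exact this
  have hHb : ∀ s ∈ Icc δ₁ δ₂, H s ≤ b := fun s hs => hb.2 ⟨s, hs, rfl⟩
  obtain ⟨c, hc, hdet⟩ := aux_det_lower h₁ h₂ h₃ hHrange hb01.2 hHb
  have hpair : ∀ s ∈ Icc δ₁ δ₂, ∀ t ∈ Icc δ₁ δ₂, ∀ x y : ℝ, ∃ v : ℝ≥0,
      P.map (fun ω => x * Y s ω + y * Y t ω) = gaussianReal 0 v := by
    intro s hs t ht x y
    obtain ⟨v, hv⟩ := hGauss 2 ![s, t] (by intro i; fin_cases i <;> simpa) ![x, y]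
    refine ⟨v, ?_⟩
    rw [← hv]
    simp [Fin.sum_univ_two]
  have hsing : ∀ s ∈ Icc δ₁ δ₂, ∃ v : ℝ≥0, P.map (Y s) = gaussianReal 0 v := by
    intro s hs
    obtain ⟨v, hv⟩ := hpair s hs s hs 1 0
    refine ⟨v, ?_⟩
    rw [← hv]
    simp
  have hYm : ∀ s ∈ Icc δ₁ δ₂, AEMeasurable (Y s) P := by
    intro s hs
    obtain ⟨v, hv⟩ := hsing s hs
    exact (aux_var hv).1
  obtain ⟨Z, hZc, hZm, hZY⟩ := aux_version P h₂ Y hYm hcont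
  have hZYs : ∀ s ∈ Icc δ₁ δ₂, Z s =ᵐ[P] Y s := by
    intro s hs
    filter_upwards [hZY] with ω hω using hω s hs
  have hZpair : ∀ s ∈ Icc δ₁ δ₂, ∀ t ∈ Icc δ₁ δ₂, ∀ x y : ℝ, ∃ v : ℝ≥0,
      P.map (fun ω => x * Z s ω + y * Z t ω) = gaussianReal 0 v := by
    intro s hs t ht x y
    obtain ⟨v, hv⟩ := hpair s hs t ht x y
    refine ⟨v, ?_⟩
    rw [← hv]
    refine Measure.map_congr ?_
    filter_upwards [hZYs s hs, hZYs t ht] with ω e1 e2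
    rw [e1, e2]
  have hZcov : ∀ s ∈ Set.Icc δ₁ δ₂, ∀ t ∈ Set.Icc δ₁ δ₂,
      (∫ ω, Z s ω * Z t ω ∂P) = ∫ x : ℝ, gKer H s x * gKer H t x := by
    intro s hs t ht
    rw [← hcov s hs t ht]
    refine integral_congr_ae ?_
    filter_upwards [hZYs s hs, hZYs t ht] with ω e1 e2
    rw [e1, e2]
  have hlt : ∀ s ∈ Icc δ₁ δ₂, ∀ t ∈ Icc δ₁ δ₂, s < t → ∀ ε : ℝ, 0 < ε →
      P {ω | |Z s ω| ≤ ε ∧ |Z t ω| ≤ ε} ≤ ENNReal.ofReal (2 * ε) * ENNReal.ofReal (2 * ε) *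
        (ENNReal.ofReal (Real.sqrt c)⁻¹ * edist s t ^ (-b)) := by
    intro s hs t ht hst ε hε
    obtain ⟨hs0, hs1⟩ := hdet s hs
    obtain ⟨hd, hle⟩ := aux_two_bound hc hst (hs1 t ht hst)
    refine (aux_gauss P (Z s) (Z t) (hZpair s hs t ht) _ _ _ (hZcov s hs s hs) (hZcov t ht t ht)
      (hZcov s hs t ht) hd hs0 ε hε).trans ?_
    gcongr
  have htwo : ∀ s ∈ Icc δ₁ δ₂, ∀ t ∈ Icc δ₁ δ₂, ∀ ε : ℝ, 0 < ε →
      P {ω | |Z s ω| ≤ ε ∧ |Z t ω| ≤ ε} ≤ ENNReal.ofReal (2 * ε) * ENNReal.ofReal (2 * ε) *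
        (ENNReal.ofReal (Real.sqrt c)⁻¹ * edist s t ^ (-b)) := by
    intro s hs t ht ε hε
    rcases lt_trichotomy s t with h | h | h
    · exact hlt s hs t ht h ε hε
    · subst h
      have n1 : ENNReal.ofReal (2 * ε) ≠ 0 := by simpa using hε
      have n2 : ENNReal.ofReal (Real.sqrt c)⁻¹ ≠ 0 := by simpa using hc
      rw [edist_self, ENNReal.zero_rpow_of_neg (by linarith [hb01.1]), ENNReal.mul_top n2,
        ENNReal.mul_top (mul_ne_zero n1 n1)]
      exact le_top
    · have := hlt t ht s hs h ε hε
      rw [edist_comm]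
      refine le_trans (measure_mono ?_) this
      exact fun ω hω => ⟨hω.2, hω.1⟩
  have hone : ∀ s ∈ Icc δ₁ δ₂, ∃ p : ℝ≥0∞, p ≠ 0 ∧ ∀ ε : ℝ, 0 < ε → ε ≤ 1 →
      ENNReal.ofReal (2 * ε) * p ≤ P {ω | |Z s ω| ≤ ε} := by
    intro s hs
    obtain ⟨v, hv⟩ := hsing s hs
    rw [← Measure.map_congr (hZYs s hs)] at hv
    have hv0 : v ≠ 0 := by
      rintro rfl
      have e1 := (aux_var hv).2.2.2
      rw [hZcov s hs s hs] at e1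
      have := (hdet s hs).1
      rw [e1] at this
      simp at this
    obtain ⟨p, hp0, hp⟩ := aux_gauss_lower v hv0
    refine ⟨p, hp0, fun ε hε hε1 => (hp ε hε hε1).trans ?_⟩
    rw [← hv, Measure.map_apply (hZm s) measurableSet_Icc]
    exact measure_mono fun ω hω => abs_le.2 hω
  obtain ⟨D, hD, hDdim⟩ := aux_core P h₂ hb01.1 hb01.2 Z hZc hZm _ ENNReal.ofReal_ne_top htwo hone
  refine ⟨D ∩ {ω | ∀ s ∈ Icc δ₁ δ₂, Z s ω = Y s ω}, ?_, ?_⟩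
  · have hnull : P {ω | ∀ s ∈ Icc δ₁ δ₂, Z s ω = Y s ω}ᶜ = 0 := ae_iff.1 hZY
    rw [measure_inter_conull hnull]
    exact hD
  · rintro ω ⟨hω, hωY⟩
    refine (hDdim ω hω).trans (dimH_mono ?_)
    rintro s ⟨hs, hs0⟩
    exact ⟨hs, by rw [← hωY s hs]; exact hs0⟩

end
end

section
/- Let ψ : ℝ → ℝ be a real-valued function in the Schwartz class whose Fourier transform ψ̂(ξ) = ∫_ℝ e^{−iξx} ψ(x) dx vanishes outside the ring { ξ ∈ ℝ : 2π/3 ≤ |ξ| ≤ 8π/3 }. Define Ψ(y,θ) = ∫_ℝ (y−x)₊^{θ−1/2} ψ(x) dx for (y,θ) ∈ ℝ × (0,1). Then Ψ is well-defined and C^∞ on ℝ × (0,1), and for every pair of nonnegative integers m, n: sup{ (2+|y|)² |∂_y^m ∂_θ^n Ψ(y,θ)| : (y,θ) ∈ ℝ × (0,1) } < ∞. -/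
open MeasureTheory Set Real

noncomputable section

/-- `u₊^a`: equals `u^a` if `u > 0` and `0` otherwise. -/
def posRPow (u a : ℝ) : ℝ := if 0 < u then u ^ a else 0

/-- The Fourier transform `ψ̂(ξ) = ∫ e^{−iξx} ψ(x) dx` of a real-valued function. -/
def fourierT (ψ : ℝ → ℝ) (ξ : ℝ) : ℂ :=
  ∫ x : ℝ, Complex.exp (-(Complex.I * ξ * x)) * (ψ x : ℂ)

/-- The fractional primitive `Ψ(y,θ) = ∫ (y−x)₊^{θ−1/2} ψ(x) dx`. -/
def PsiFrac (ψ : ℝ → ℝ) (y θ : ℝ) : ℝ :=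
  ∫ x : ℝ, posRPow (y - x) (θ - 1/2) * ψ x

/-- The iterated partial derivative `∂_y^m ∂_θ^n F(y,θ)`, the `θ`-derivatives being
taken within `(0,1)`. -/
def pder (F : ℝ → ℝ → ℝ) (m n : ℕ) (y θ : ℝ) : ℝ :=
  iteratedDeriv m (fun y' => iteratedDerivWithin n (fun θ' => F y' θ') (Set.Ioo 0 1) θ) y

open scoped FourierTransform SchwartzMap ContDiff Topology

/-- A Schwartz function with Fourier support in a ring has a Schwartz primitive with the same property. -/
lemma exists_primitive (f : 𝓢(ℝ, ℂ))
    (hf : ∀ ξ : ℝ, (|ξ| < 1 / 3 ∨ 4 / 3 < |ξ|) → 𝓕 f ξ = 0) :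
    ∃ g : 𝓢(ℝ, ℂ), (∀ x, deriv g x = f x) ∧
      (∀ ξ : ℝ, (|ξ| < 1 / 3 ∨ 4 / 3 < |ξ|) → 𝓕 g ξ = 0) := by
  set h : ℝ → ℂ := fun ξ => 𝓕 f ξ / (2 * π * Complex.I * ξ) with hh
  have h1 : HasCompactSupport h := by
    apply HasCompactSupport.intro (isCompact_Icc (a := (-(4/3) : ℝ)) (b := 4/3))
    intro ξ hξ
    have : 4 / 3 < |ξ| := by
      by_contra hc
      exact hξ (abs_le.mp (not_lt.mp hc))
    simp [hh, hf ξ (Or.inr this)]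
  have h2 : ContDiff ℝ ∞ h := by
    rw [contDiff_iff_contDiffAt]
    intro ξ
    by_cases h0 : ξ = 0
    · have : h =ᶠ[𝓝 ξ] fun _ => 0 := by
        have : {x : ℝ | |x| < 1 / 3} ∈ 𝓝 ξ := by
          apply (isOpen_lt continuous_abs continuous_const).mem_nhds
          simp [h0]
        filter_upwards [this] with x hx
        simp [hh, hf x (Or.inl hx)]
      exact contDiffAt_const.congr_of_eventuallyEq this
    · have a1 : ContDiffAt ℝ ∞ (fun x : ℝ => 𝓕 f x) ξ := ((𝓕 f).smooth ⊤).contDiffAt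
      have a2 : ContDiffAt ℝ ∞ (fun x : ℝ => (2 * π * Complex.I * (x : ℂ))) ξ :=
        contDiffAt_const.mul Complex.ofRealCLM.contDiff.contDiffAt
      have a3 := a1.mul (a2.inv (by simp [h0, Real.pi_ne_zero]))
      have e : h = fun x : ℝ => 𝓕 f x * (fun x : ℝ => 2 * π * Complex.I * (x : ℂ))⁻¹ x := by
        ext x; simp only [hh, div_eq_mul_inv, Pi.inv_apply]
      rw [e]
      exact a3
  let H : 𝓢(ℝ, ℂ) := h1.toSchwartzMap h2
  have hH : ∀ ξ, H ξ = h ξ := fun ξ => rfl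
  refine ⟨𝓕⁻ H, ?_, ?_⟩
  · have key : SchwartzMap.derivCLM ℝ ℂ (𝓕⁻ H) = f := by
      have : 𝓕 (SchwartzMap.derivCLM ℝ ℂ (𝓕⁻ H)) = 𝓕 f := by
        ext ξ
        have e1 : 𝓕 (SchwartzMap.derivCLM ℝ ℂ (𝓕⁻ H)) ξ
            = 𝓕 (deriv (𝓕⁻ H : 𝓢(ℝ, ℂ))) ξ := by
          rw [SchwartzMap.fourier_coe]; rfl
        rw [e1, Real.fourier_deriv (SchwartzMap.integrable _) (SchwartzMap.differentiable _)
          ((SchwartzMap.derivCLM ℝ ℂ (𝓕⁻ H)).integrable), ← SchwartzMap.fourier_coe]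
        rw [FourierTransform.fourier_fourierInv_eq]
        simp only [hH, hh, smul_eq_mul]
        by_cases h0 : ξ = 0
        · subst h0
          rw [hf 0 (Or.inl (by norm_num))]; simp
        · have : (ξ : ℂ) ≠ 0 := by exact_mod_cast h0
          have : (π : ℂ) ≠ 0 := by exact_mod_cast Real.pi_ne_zero
          field_simp
      have := congrArg (fun g : 𝓢(ℝ, ℂ) => 𝓕⁻ g) this
      simpa [FourierTransform.fourierInv_fourier_eq] using this
    intro x
    rw [← key]; rfl
  · intro ξ hξ
    rw [FourierTransform.fourier_fourierInv_eq, hH]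
    simp [hh, hf ξ hξ]

lemma exists_third_primitive (ψ : 𝓢(ℝ, ℝ))
    (hsupp : ∀ ξ : ℝ, (|ξ| < 2 * π / 3 ∨ 8 * π / 3 < |ξ|) → fourierT (fun x => ψ x) ξ = 0) :
    ∃ χ : 𝓢(ℝ, ℝ), SchwartzMap.derivCLM ℝ ℝ (SchwartzMap.derivCLM ℝ ℝ
      (SchwartzMap.derivCLM ℝ ℝ χ)) = ψ := by
  let f : 𝓢(ℝ, ℂ) := ψ.postcompCLM (𝕜 := ℝ) Complex.ofRealCLM
  have hf : ∀ ξ : ℝ, (|ξ| < 1 / 3 ∨ 4 / 3 < |ξ|) → 𝓕 f ξ = 0 := by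
    intro ξ hξ
    have e : 𝓕 f ξ = fourierT (fun x => ψ x) (2 * π * ξ) := by
      rw [SchwartzMap.fourier_coe, Real.fourier_real_eq_integral_exp_smul, fourierT]
      congr 1
      ext x
      simp only [smul_eq_mul]
      congr 2
      push_cast; ring
    rw [e]
    apply hsupp
    have hp := Real.pi_pos
    rw [abs_mul, abs_of_pos (by positivity : 0 < 2 * π)]
    rcases hξ with h | h
    · left; nlinarith
    · right; nlinarith
  have real : ∀ (p q : 𝓢(ℝ, ℂ)), (∀ x, deriv q x = p x) →
      SchwartzMap.derivCLM ℝ ℝ (q.postcompCLM (𝕜 := ℝ) Complex.reCLM)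
        = p.postcompCLM (𝕜 := ℝ) Complex.reCLM := by
    intro p q h
    ext x
    rw [SchwartzMap.derivCLM_apply, SchwartzMap.postcompCLM_apply, ← h x]
    have := (Complex.reCLM.hasFDerivAt.comp_hasDerivAt x
      (q.differentiable.differentiableAt (x := x)).hasDerivAt)
    exact this.deriv
  obtain ⟨g1, d1, hg1⟩ := exists_primitive f hf
  obtain ⟨g2, d2, hg2⟩ := exists_primitive g1 hg1
  obtain ⟨g3, d3, hg3⟩ := exists_primitive g2 hg2
  refine ⟨g3.postcompCLM (𝕜 := ℝ) Complex.reCLM, ?_⟩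
  rw [real _ _ d3, real _ _ d2, real _ _ d1]
  ext x
  simp [f]


/-- The kernel `u^b (log u)^n`. -/
def kerL (n : ℕ) (b u : ℝ) : ℝ := u ^ b * (Real.log u) ^ n

lemma log_bound1 (n : ℕ) : ∃ C : ℝ, 0 ≤ C ∧ ∀ u : ℝ, 1 ≤ u → |Real.log u| ^ n ≤ C * u ^ (1/4 : ℝ) := by
  refine ⟨(4 * (n + 1)) ^ n, by positivity, fun u hu => ?_⟩
  have hu0 : 0 < u := by linarith
  have he : (0 : ℝ) < 1 / (4 * (n + 1)) := by positivity
  have h1 := Real.log_le_rpow_div hu0.le he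
  rw [abs_of_nonneg (Real.log_nonneg hu)]
  calc Real.log u ^ n ≤ (u ^ (1 / (4 * (n + 1)) : ℝ) / (1 / (4 * (n + 1)))) ^ n :=
        pow_le_pow_left₀ (Real.log_nonneg hu) h1 n
    _ = (4 * (n + 1)) ^ n * (u ^ ((1 / (4 * (n + 1)) * n : ℝ))) := by
        rw [Real.rpow_mul_natCast hu0.le, div_pow, div_eq_mul_inv, mul_comm]
        congr 1
        rw [one_div, inv_pow, inv_inv]
    _ ≤ (4 * (n + 1)) ^ n * u ^ (1/4 : ℝ) := by
        gcongr
        rw [div_mul_eq_mul_div, div_le_div_iff₀ (by positivity) (by positivity)]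
        nlinarith

lemma log_bound0 (n : ℕ) : ∃ C : ℝ, 0 ≤ C ∧ ∀ u : ℝ, 0 < u → u ≤ 1 →
    |Real.log u| ^ n ≤ C * u ^ (-1/4 : ℝ) := by
  obtain ⟨C, hC, h⟩ := log_bound1 n
  refine ⟨C, hC, fun u hu hu1 => ?_⟩
  have := h u⁻¹ (one_le_inv_iff₀.mpr ⟨hu, hu1⟩)
  rw [Real.log_inv, abs_neg, Real.inv_rpow hu.le, ← Real.rpow_neg hu.le] at this
  convert this using 3
  norm_num

lemma kerL_bound1 (n : ℕ) : ∃ C : ℝ, 0 ≤ C ∧ ∀ b u : ℝ, 1 ≤ u →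
    |kerL n b u| ≤ C * u ^ (b + 1/4) := by
  obtain ⟨C, hC, h⟩ := log_bound1 n
  refine ⟨C, hC, fun b u hu => ?_⟩
  have hu0 : 0 < u := by linarith
  rw [kerL, abs_mul, abs_pow, abs_of_pos (Real.rpow_pos_of_pos hu0 b), Real.rpow_add hu0]
  nlinarith [h u hu, Real.rpow_pos_of_pos hu0 b]

lemma kerL_bound0 (n : ℕ) : ∃ C : ℝ, 0 ≤ C ∧ ∀ b u : ℝ, -1/2 ≤ b → 0 < u → u ≤ 1 →
    |kerL n b u| ≤ C * u ^ (-3/4 : ℝ) := by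
  obtain ⟨C, hC, h⟩ := log_bound0 n
  refine ⟨C, hC, fun b u hb hu0 hu => ?_⟩
  rw [kerL, abs_mul, abs_pow, abs_of_pos (Real.rpow_pos_of_pos hu0 b)]
  have e : (-3/4 : ℝ) = -1/2 + -1/4 := by norm_num
  rw [e, Real.rpow_add hu0]
  have h2 : u ^ b ≤ u ^ (-1/2 : ℝ) := Real.rpow_le_rpow_of_exponent_ge hu0 hu hb
  calc u ^ b * |Real.log u| ^ n ≤ u ^ (-1/2 : ℝ) * (C * u ^ (-1/4 : ℝ)) := by
        gcongr
        exact h u hu0 hu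
    _ = _ := by ring

lemma schwartz_decay (φ : 𝓢(ℝ, ℝ)) (k : ℕ) :
    ∃ C : ℝ, 0 ≤ C ∧ ∀ x, (2 + |x|) ^ k * |φ x| ≤ C := by
  refine ⟨2 ^ k * (2 ^ k * ((Finset.Iic (k, 0)).sup fun m => SchwartzMap.seminorm ℝ m.1 m.2) φ),
    by positivity, fun x => ?_⟩
  have := SchwartzMap.one_add_le_sup_seminorm_apply (𝕜 := ℝ) (m := (k, 0)) (k := k) (n := 0)
    le_rfl le_rfl φ x
  simp only [norm_iteratedFDeriv_zero, Real.norm_eq_abs] at this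
  calc (2 + |x|) ^ k * |φ x| ≤ (2 * (1 + |x|)) ^ k * |φ x| := by
        gcongr
        linarith [abs_nonneg x]
    _ = 2 ^ k * ((1 + |x|) ^ k * |φ x|) := by rw [mul_pow]; ring
    _ ≤ _ := by gcongr

/-- weighted bound on `(0,1]` -/
lemma prod_bound0 (n : ℕ) (φ : 𝓢(ℝ, ℝ)) : ∃ C : ℝ, 0 ≤ C ∧ ∀ b y u : ℝ, -1/2 ≤ b → 0 < u → u ≤ 1 →
    (2 + |y|) ^ 2 * |kerL n b u * φ (y - u)| ≤ C * u ^ (-3/4 : ℝ) := by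
  obtain ⟨C, hC, h⟩ := kerL_bound0 n
  obtain ⟨D, hD, hφ⟩ := schwartz_decay φ 2
  refine ⟨4 * D * C, by positivity, fun b y u hb hu0 hu => ?_⟩
  have h1 : 2 + |y| ≤ 2 * (2 + |y - u|) := by
    have := abs_sub_abs_le_abs_sub y u
    rw [abs_of_pos hu0] at this
    linarith [abs_nonneg (y - u)]
  have h2 : (2 + |y|) ^ 2 * |φ (y - u)| ≤ 4 * D := by
    calc (2 + |y|) ^ 2 * |φ (y - u)| ≤ (2 * (2 + |y - u|)) ^ 2 * |φ (y - u)| := by gcongr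
      _ = 4 * ((2 + |y - u|) ^ 2 * |φ (y - u)|) := by ring
      _ ≤ _ := by gcongr; exact hφ _
  rw [abs_mul]
  calc (2 + |y|) ^ 2 * (|kerL n b u| * |φ (y - u)|)
      = ((2 + |y|) ^ 2 * |φ (y - u)|) * |kerL n b u| := by ring
    _ ≤ (4 * D) * (C * u ^ (-3/4 : ℝ)) := by
        gcongr
        exact h b u hb hu0 hu
    _ = _ := by ring

lemma two_add_le (y u : ℝ) (hu : 0 ≤ u) : 2 + u ≤ (2 + |y|) * (2 + |y - u|) := by
  have := abs_sub_abs_le_abs_sub u y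
  rw [abs_of_nonneg hu, abs_sub_comm] at this
  nlinarith [abs_nonneg y, abs_nonneg (y - u)]

lemma two_add_le' (y u : ℝ) (hu : 0 ≤ u) : 2 + |y| ≤ (2 + u) * (2 + |y - u|) := by
  have := abs_sub_abs_le_abs_sub y u
  rw [abs_of_nonneg hu] at this
  nlinarith [abs_nonneg y, abs_nonneg (y - u)]

/-- integrability bound on `[1,∞)` -/
lemma prod_bound1 (n : ℕ) (φ : 𝓢(ℝ, ℝ)) : ∃ C : ℝ, 0 ≤ C ∧ ∀ b y u : ℝ, b ≤ 1/2 → 1 ≤ u →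
    |kerL n b u * φ (y - u)| ≤ C * (2 + |y|) ^ 3 * u ^ (-2 : ℝ) := by
  obtain ⟨C, hC, h⟩ := kerL_bound1 n
  obtain ⟨D, hD, hφ⟩ := schwartz_decay φ 3
  refine ⟨C * D, by positivity, fun b y u hb hu => ?_⟩
  have hu0 : 0 < u := by linarith
  have h1 : u ^ 3 * |φ (y - u)| ≤ D * (2 + |y|) ^ 3 := by
    calc u ^ 3 * |φ (y - u)| ≤ ((2 + |y|) * (2 + |y - u|)) ^ 3 * |φ (y - u)| := by
          gcongr
          linarith [two_add_le y u hu0.le]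
      _ = ((2 + |y - u|) ^ 3 * |φ (y - u)|) * (2 + |y|) ^ 3 := by ring
      _ ≤ _ := by gcongr; exact hφ _
  have h2 : |kerL n b u| ≤ C * u := by
    refine (h b u hu).trans ?_
    gcongr
    calc u ^ (b + 1/4) ≤ u ^ (1 : ℝ) := Real.rpow_le_rpow_of_exponent_le hu (by linarith)
      _ = u := Real.rpow_one u
  have h3 : u ^ (-2 : ℝ) = (u ^ 2)⁻¹ := by
    rw [Real.rpow_neg hu0.le]; norm_num
  rw [abs_mul, h3, ← div_eq_mul_inv, le_div_iff₀ (by positivity)]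
  calc |kerL n b u| * |φ (y - u)| * u ^ 2 ≤ C * u * |φ (y - u)| * u ^ 2 := by gcongr
    _ = C * (u ^ 3 * |φ (y - u)|) := by ring
    _ ≤ C * (D * (2 + |y|) ^ 3) := by gcongr
    _ = _ := by ring

/-- weighted bound on `[1,∞)` for very negative exponents -/
lemma prod_bound2 (n : ℕ) (φ : 𝓢(ℝ, ℝ)) : ∃ C : ℝ, 0 ≤ C ∧ ∀ b y u : ℝ, b ≤ -5/2 → 1 ≤ u →
    (2 + |y|) ^ 2 * |kerL n b u * φ (y - u)| ≤ C * (1 + (y - u) ^ 2)⁻¹ := by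
  obtain ⟨C, hC, h⟩ := kerL_bound1 n
  obtain ⟨D, hD, hφ⟩ := schwartz_decay φ 4
  refine ⟨9 * C * D, by positivity, fun b y u hb hu => ?_⟩
  have hu0 : 0 < u := by linarith
  have h2 : u ^ 2 * |kerL n b u| ≤ C := by
    have e : u ^ 2 * u ^ (b + 1/4) ≤ 1 := by
      rw [← Real.rpow_natCast, ← Real.rpow_add hu0]
      apply Real.rpow_le_one_of_one_le_of_nonpos hu
      push_cast; linarith
    calc u ^ 2 * |kerL n b u| ≤ u ^ 2 * (C * u ^ (b + 1/4)) := by gcongr; exact h b u hu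
      _ = C * (u ^ 2 * u ^ (b + 1/4)) := by ring
      _ ≤ C * 1 := by gcongr
      _ = C := mul_one C
  have h1 : 2 + |y| ≤ 3 * u * (2 + |y - u|) := by
    refine (two_add_le' y u hu0.le).trans ?_
    gcongr
    linarith
  have h4 : 1 + (y - u) ^ 2 ≤ (2 + |y - u|) ^ 2 := by
    nlinarith [abs_nonneg (y - u), sq_abs (y - u)]
  rw [abs_mul, ← div_eq_mul_inv, le_div_iff₀ (by positivity)]
  calc (2 + |y|) ^ 2 * (|kerL n b u| * |φ (y - u)|) * (1 + (y - u) ^ 2)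
      ≤ (3 * u * (2 + |y - u|)) ^ 2 * (|kerL n b u| * |φ (y - u)|) * (2 + |y - u|) ^ 2 := by gcongr
    _ = 9 * (u ^ 2 * |kerL n b u|) * ((2 + |y - u|) ^ 4 * |φ (y - u)|) := by ring
    _ ≤ 9 * C * D := by gcongr; exact hφ _

/-- The dominating function. -/
def domW (u : ℝ) : ℝ := if u ≤ 1 then u ^ (-3/4 : ℝ) else u ^ (-2 : ℝ)

lemma int34 : IntegrableOn (fun u : ℝ => u ^ (-3/4 : ℝ)) (Ioc 0 1) := by
  have := intervalIntegral.intervalIntegrable_rpow' (a := 0) (b := 1) (r := -3/4) (by norm_num)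
  rwa [intervalIntegrable_iff_integrableOn_Ioc_of_le zero_le_one] at this

lemma int2 : IntegrableOn (fun u : ℝ => u ^ (-2 : ℝ)) (Ioi 1) :=
  integrableOn_Ioi_rpow_of_lt (by norm_num) zero_lt_one

lemma domW_int : IntegrableOn domW (Ioi 0) := by
  rw [← Ioc_union_Ioi_eq_Ioi zero_le_one]
  refine IntegrableOn.union ?_ ?_
  · refine int34.congr_fun (fun u hu => ?_) measurableSet_Ioc
    simp [domW, hu.2]
  · refine int2.congr_fun (fun u hu => ?_) measurableSet_Ioi
    simp [domW, not_le.mpr (mem_Ioi.mp hu)]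

lemma prod_bound (n : ℕ) (φ : 𝓢(ℝ, ℝ)) : ∃ C : ℝ, 0 ≤ C ∧ ∀ b y u : ℝ, -1/2 ≤ b → b ≤ 1/2 → 0 < u →
    |kerL n b u * φ (y - u)| ≤ C * (2 + |y|) ^ 3 * domW u := by
  obtain ⟨C, hC, h⟩ := prod_bound0 n φ
  obtain ⟨D, hD, h'⟩ := prod_bound1 n φ
  refine ⟨C + D, by positivity, fun b y u hb hb' hu => ?_⟩
  have hy := abs_nonneg y
  have hone : 1 ≤ (2 + |y|) ^ 2 := one_le_pow₀ (by linarith)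
  have hone' : 1 ≤ (2 + |y|) ^ 3 := one_le_pow₀ (by linarith)
  by_cases h1 : u ≤ 1
  · have := h b y u hb hu h1
    simp only [domW, h1, if_true]
    have hp : 0 ≤ u ^ (-3/4 : ℝ) := by positivity
    calc |kerL n b u * φ (y - u)| ≤ (2 + |y|) ^ 2 * |kerL n b u * φ (y - u)| :=
          le_mul_of_one_le_left (abs_nonneg _) hone
      _ ≤ C * u ^ (-3/4 : ℝ) := this
      _ ≤ (C + D) * (2 + |y|) ^ 3 * u ^ (-3/4 : ℝ) := by
          gcongr
          nlinarith
  · have := h' b y u hb' (not_le.mp h1).le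
    simp only [domW, h1, if_false]
    refine this.trans ?_
    gcongr
    linarith

lemma kerL_meas (n : ℕ) (b : ℝ) : Measurable (kerL n b) := by
  unfold kerL; fun_prop

lemma prod_meas (n : ℕ) (b y : ℝ) (φ : 𝓢(ℝ, ℝ)) :
    Measurable (fun u => kerL n b u * φ (y - u)) :=
  (kerL_meas n b).mul (φ.continuous.measurable.comp (measurable_const.sub measurable_id))

lemma prod_int (n : ℕ) (b y : ℝ) (φ : 𝓢(ℝ, ℝ)) (hb : -1/2 ≤ b) (hb' : b ≤ 1/2) :
    IntegrableOn (fun u => kerL n b u * φ (y - u)) (Ioi 0) := by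
  obtain ⟨C, hC, h⟩ := prod_bound n φ
  refine Integrable.mono' (domW_int.const_mul (C * (2 + |y|) ^ 3))
    (prod_meas n b y φ).aestronglyMeasurable ?_
  filter_upwards [ae_restrict_mem measurableSet_Ioi] with u hu
  exact h b y u hb hb' hu

lemma prod_int1 (n : ℕ) (b y : ℝ) (φ : 𝓢(ℝ, ℝ)) (hb' : b ≤ 1/2) :
    IntegrableOn (fun u => kerL n b u * φ (y - u)) (Ioi 1) := by
  obtain ⟨C, hC, h⟩ := prod_bound1 n φ
  refine Integrable.mono' (int2.const_mul (C * (2 + |y|) ^ 3))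
    (prod_meas n b y φ).aestronglyMeasurable ?_
  filter_upwards [ae_restrict_mem measurableSet_Ioi] with u hu
  exact h b y u hb' (le_of_lt hu)

/-- `∫_1^∞ u^b (log u)^n φ(y-u) du`. -/
def GInt (n : ℕ) (b : ℝ) (φ : 𝓢(ℝ, ℝ)) (y : ℝ) : ℝ := ∫ u in Ioi 1, kerL n b u * φ (y - u)

/-- `∫_0^∞ u^(θ-1/2) (log u)^n φ(y-u) du`. -/
def FInt (n : ℕ) (φ : 𝓢(ℝ, ℝ)) (y θ : ℝ) : ℝ :=
  ∫ u in Ioi 0, kerL n (θ - 1/2) u * φ (y - u)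

lemma kerL_deriv (n : ℕ) (b u : ℝ) (hu : 0 < u) :
    HasDerivAt (kerL n b) (b * kerL n (b - 1) u + n * kerL (n - 1) (b - 1) u) u := by
  have h1 := (Real.hasDerivAt_rpow_const (x := u) (p := b) (Or.inl hu.ne'))
  have h2 := (Real.hasDerivAt_log hu.ne').pow n
  have h3 := h1.mul h2
  refine h3.congr_deriv ?_
  simp only [kerL, Pi.pow_apply]
  rw [Real.rpow_sub_one hu.ne']
  field_simp

lemma schwartz_sub_deriv (φ : 𝓢(ℝ, ℝ)) (y u : ℝ) :
    HasDerivAt (fun u => -φ (y - u)) (SchwartzMap.derivCLM ℝ ℝ φ (y - u)) u := by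
  have h := (φ.differentiable.differentiableAt (x := y - u)).hasDerivAt
  have h2 := (h.comp u ((hasDerivAt_id u).const_sub y)).neg
  simp only [mul_neg, mul_one, neg_neg] at h2
  exact h2

lemma GInt_parts (n : ℕ) (b : ℝ) (φ : 𝓢(ℝ, ℝ)) (y : ℝ) (hb : b ≤ 1/2) :
    GInt n b (SchwartzMap.derivCLM ℝ ℝ φ) y =
      kerL n b 1 * φ (y - 1) + b * GInt n (b - 1) φ y + n * GInt (n - 1) (b - 1) φ y := by
  have i1 := prod_int1 n (b - 1) y φ (by linarith)
  have i2 := prod_int1 (n - 1) (b - 1) y φ (by linarith)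
  have i3 := (i1.const_mul b).add (i2.const_mul (n : ℝ))
  have key := integral_Ioi_mul_deriv_eq_deriv_mul (a := 1) (u := kerL n b)
    (v := fun u => -φ (y - u)) (v' := fun u => SchwartzMap.derivCLM ℝ ℝ φ (y - u))
    (u' := fun u => b * kerL n (b - 1) u + n * kerL (n - 1) (b - 1) u)
    (a' := kerL n b 1 * -φ (y - 1)) (b' := 0)
    (fun u hu => kerL_deriv n b u (lt_trans zero_lt_one hu))
    (fun u _ => schwartz_sub_deriv φ y u)
    (prod_int1 n b y _ hb)
    (by
      refine i3.neg.congr (Filter.Eventually.of_forall fun u => ?_)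
      simp only [Pi.neg_apply, Pi.add_apply, Pi.mul_apply]
      ring)
    (by
      apply Filter.Tendsto.mono_left _ nhdsWithin_le_nhds
      exact ((kerL_deriv n b 1 one_pos).continuousAt.mul
        (schwartz_sub_deriv φ y 1).continuousAt))
    (by
      obtain ⟨C, hC, h⟩ := prod_bound1 n φ
      have ht : Filter.Tendsto (fun u : ℝ => C * (2 + |y|) ^ 3 * u ^ (-2 : ℝ)) Filter.atTop (𝓝 0) := by
        simpa using (tendsto_rpow_neg_atTop (y := 2) (by norm_num)).const_mul (C * (2 + |y|) ^ 3)
      refine squeeze_zero_norm' ?_ ht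
      filter_upwards [Filter.eventually_ge_atTop 1] with u hu
      have := h b y u hb hu
      simpa [abs_mul] using this)
  unfold GInt
  rw [key]
  have e : ∫ u in Ioi 1, (b * kerL n (b - 1) u + n * kerL (n - 1) (b - 1) u) * -φ (y - u)
      = -(b * (∫ u in Ioi 1, kerL n (b - 1) u * φ (y - u))
        + n * ∫ u in Ioi 1, kerL (n - 1) (b - 1) u * φ (y - u)) := by
    rw [← integral_const_mul, ← integral_const_mul, ← integral_add (i1.const_mul b) (i2.const_mul _),
      ← integral_neg]
    congr 1
    ext u
    ring
  rw [e]
  ring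

/-- Uniform localization of `GInt`. -/
def GLoc (k : ℝ) (φ : 𝓢(ℝ, ℝ)) : Prop :=
  ∀ n : ℕ, ∃ C : ℝ, ∀ b y : ℝ, -1/2 - k ≤ b → b ≤ 1/2 - k → (2 + |y|) ^ 2 * |GInt n b φ y| ≤ C

lemma GLoc_three (φ : 𝓢(ℝ, ℝ)) : GLoc 3 φ := by
  intro n
  obtain ⟨C, hC, h⟩ := prod_bound2 n φ
  refine ⟨C * π, fun b y _ hb => ?_⟩
  have hi : Integrable (fun u : ℝ => C * (1 + (y - u) ^ 2)⁻¹) :=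
    (integrable_inv_one_add_sq.comp_sub_left y).const_mul C
  calc (2 + |y|) ^ 2 * |GInt n b φ y| = ‖∫ u in Ioi 1, (2 + |y|) ^ 2 * (kerL n b u * φ (y - u))‖ := by
        rw [integral_const_mul, Real.norm_eq_abs, abs_mul, abs_of_pos (a := (2 + |y|) ^ 2) (by positivity), GInt]
    _ ≤ ∫ u in Ioi 1, C * (1 + (y - u) ^ 2)⁻¹ := by
        apply norm_integral_le_of_norm_le hi.integrableOn
        filter_upwards [ae_restrict_mem measurableSet_Ioi] with u hu
        rw [Real.norm_eq_abs, abs_mul, abs_of_pos (a := (2 + |y|) ^ 2) (by positivity)]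
        exact h b y u (by linarith) (le_of_lt hu)
    _ ≤ ∫ u, C * (1 + (y - u) ^ 2)⁻¹ :=
        setIntegral_le_integral hi (Filter.Eventually.of_forall fun u => by positivity)
    _ = C * π := by
        rw [integral_const_mul, integral_sub_left_eq_self (fun u : ℝ => (1 + u ^ 2)⁻¹) volume y,
          integral_univ_inv_one_add_sq]

lemma GLoc_step (k : ℝ) (hk : 0 ≤ k) (φ : 𝓢(ℝ, ℝ)) (h : GLoc (k + 1) φ) :
    GLoc k (SchwartzMap.derivCLM ℝ ℝ φ) := by
  intro n
  obtain ⟨C1, h1⟩ := h n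
  obtain ⟨C2, h2⟩ := h (n - 1)
  obtain ⟨D, hD, hφ⟩ := schwartz_decay φ 2
  refine ⟨4 * D + (k + 1) * C1 + n * C2, fun b y hb hb' => ?_⟩
  rw [GInt_parts n b φ y (by linarith)]
  have a1 := h1 (b - 1) y (by linarith) (by linarith)
  have a2 := h2 (b - 1) y (by linarith) (by linarith)
  have k1 : |kerL n b 1| ≤ 1 := by
    rw [kerL, Real.one_rpow, Real.log_one, one_mul, abs_pow, abs_zero]
    exact pow_le_one₀ le_rfl zero_le_one
  have y1 : 2 + |y| ≤ 2 * (2 + |y - 1|) := by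
    have := abs_sub_abs_le_abs_sub y 1
    rw [abs_one] at this
    linarith [abs_nonneg (y - 1)]
  have b1 : (2 + |y|) ^ 2 * |kerL n b 1 * φ (y - 1)| ≤ 4 * D := by
    rw [abs_mul]
    calc (2 + |y|) ^ 2 * (|kerL n b 1| * |φ (y - 1)|)
        ≤ (2 * (2 + |y - 1|)) ^ 2 * (1 * |φ (y - 1)|) := by gcongr
      _ = 4 * ((2 + |y - 1|) ^ 2 * |φ (y - 1)|) := by ring
      _ ≤ _ := by gcongr; exact hφ _
  have hbk : |b| ≤ k + 1 := abs_le.mpr ⟨by linarith, by linarith⟩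
  have b2 : (2 + |y|) ^ 2 * |b * GInt n (b - 1) φ y| ≤ (k + 1) * C1 := by
    rw [abs_mul]
    calc (2 + |y|) ^ 2 * (|b| * |GInt n (b - 1) φ y|)
        = |b| * ((2 + |y|) ^ 2 * |GInt n (b - 1) φ y|) := by ring
      _ ≤ (k + 1) * C1 := by gcongr
  have b3 : (2 + |y|) ^ 2 * |n * GInt (n - 1) (b - 1) φ y| ≤ n * C2 := by
    rw [abs_mul, Nat.abs_cast]
    calc (2 + |y|) ^ 2 * (n * |GInt (n - 1) (b - 1) φ y|)
        = n * ((2 + |y|) ^ 2 * |GInt (n - 1) (b - 1) φ y|) := by ring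
      _ ≤ n * C2 := by gcongr
  calc _ ≤ (2 + |y|) ^ 2 * (|kerL n b 1 * φ (y - 1)| + |b * GInt n (b - 1) φ y|
        + |n * GInt (n - 1) (b - 1) φ y|) := by
        gcongr
        exact abs_add_three _ _ _
    _ ≤ _ := by linarith

lemma FInt_loc (n : ℕ) (χ : 𝓢(ℝ, ℝ)) : ∃ C : ℝ, ∀ y : ℝ, ∀ θ ∈ Ioo (0 : ℝ) 1,
    (2 + |y|) ^ 2 * |FInt n (SchwartzMap.derivCLM ℝ ℝ (SchwartzMap.derivCLM ℝ ℝ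
      (SchwartzMap.derivCLM ℝ ℝ χ))) y θ| ≤ C := by
  have g3 := GLoc_three χ
  have g2 := GLoc_step 2 (by norm_num) χ (by norm_num; exact g3)
  have g1 := GLoc_step 1 (by norm_num) _ (by norm_num; exact g2)
  have g0 := GLoc_step 0 (by norm_num) _ (by norm_num; exact g1)
  generalize SchwartzMap.derivCLM ℝ ℝ (SchwartzMap.derivCLM ℝ ℝ
      (SchwartzMap.derivCLM ℝ ℝ χ)) = φ at g0
  obtain ⟨C1, h1⟩ := g0 n
  obtain ⟨C0, hC0, h0⟩ := prod_bound0 n φ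
  refine ⟨C0 * (∫ u in Ioc (0:ℝ) 1, u ^ (-3/4 : ℝ)) + C1, fun y θ hθ => ?_⟩
  obtain ⟨t0, t1⟩ := hθ
  have hi := prod_int n (θ - 1/2) y φ (by linarith) (by linarith)
  have e : FInt n φ y θ = (∫ u in Ioc 0 1, kerL n (θ - 1/2) u * φ (y - u))
      + GInt n (θ - 1/2) φ y := by
    rw [FInt, GInt, ← setIntegral_union (Ioc_disjoint_Ioi le_rfl) measurableSet_Ioi
      (hi.mono_set Ioc_subset_Ioi_self) (hi.mono_set (Ioi_subset_Ioi zero_le_one)),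
      Ioc_union_Ioi_eq_Ioi zero_le_one]
  have b0 : (2 + |y|) ^ 2 * |∫ u in Ioc 0 1, kerL n (θ - 1/2) u * φ (y - u)|
      ≤ C0 * (∫ u in Ioc (0:ℝ) 1, u ^ (-3/4 : ℝ)) := by
    calc _ = ‖∫ u in Ioc 0 1, (2 + |y|) ^ 2 * (kerL n (θ - 1/2) u * φ (y - u))‖ := by
          rw [integral_const_mul, Real.norm_eq_abs, abs_mul, abs_of_pos (a := (2 + |y|) ^ 2) (by positivity)]
      _ ≤ ∫ u in Ioc (0:ℝ) 1, C0 * u ^ (-3/4 : ℝ) := by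
          apply norm_integral_le_of_norm_le (int34.const_mul C0)
          filter_upwards [ae_restrict_mem measurableSet_Ioc] with u hu
          rw [Real.norm_eq_abs, abs_mul, abs_of_pos (a := (2 + |y|) ^ 2) (by positivity)]
          exact h0 _ y u (by linarith) hu.1 hu.2
      _ = _ := by rw [integral_const_mul]
  have b1 := h1 (θ - 1/2) y (by linarith) (by linarith)
  rw [e]
  calc _ ≤ (2 + |y|) ^ 2 * (|∫ u in Ioc 0 1, kerL n (θ - 1/2) u * φ (y - u)|
        + |GInt n (θ - 1/2) φ y|) := by
        gcongr
        exact abs_add_le _ _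
    _ ≤ _ := by linarith


lemma kerL_hasDerivAt_exp (n : ℕ) (b u : ℝ) (hu : 0 < u) :
    HasDerivAt (fun b => kerL n b u) (kerL (n + 1) b u) b := by
  have h := ((Real.hasStrictDerivAt_const_rpow hu b).hasDerivAt).mul_const (Real.log u ^ n)
  refine h.congr_deriv ?_
  simp only [kerL]; ring

/-- The integrand's Fréchet derivative. -/
def fderL (n : ℕ) (φ : 𝓢(ℝ, ℝ)) (p : ℝ × ℝ) (u : ℝ) : ℝ × ℝ →L[ℝ] ℝ :=
  (kerL n (p.2 - 1/2) u * SchwartzMap.derivCLM ℝ ℝ φ (p.1 - u)) • ContinuousLinearMap.fst ℝ ℝ ℝ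
  + (kerL (n + 1) (p.2 - 1/2) u * φ (p.1 - u)) • ContinuousLinearMap.snd ℝ ℝ ℝ

lemma integrand_hasFDerivAt (n : ℕ) (φ : 𝓢(ℝ, ℝ)) (p : ℝ × ℝ) (u : ℝ) (hu : 0 < u) :
    HasFDerivAt (fun p : ℝ × ℝ => kerL n (p.2 - 1/2) u * φ (p.1 - u)) (fderL n φ p u) p := by
  have s1 : HasFDerivAt (fun p : ℝ × ℝ => p.2 - 1/2) (ContinuousLinearMap.snd ℝ ℝ ℝ) p :=
    hasFDerivAt_snd.sub_const (1/2 : ℝ)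
  have s2 : HasFDerivAt (fun p : ℝ × ℝ => p.1 - u) (ContinuousLinearMap.fst ℝ ℝ ℝ) p :=
    hasFDerivAt_fst.sub_const u
  have h1 : HasFDerivAt (fun p : ℝ × ℝ => kerL n (p.2 - 1/2) u)
      ((kerL (n + 1) (p.2 - 1/2) u) • ContinuousLinearMap.snd ℝ ℝ ℝ) p :=
    HasDerivAt.comp_hasFDerivAt (h₂ := fun b => kerL n b u) p
      (kerL_hasDerivAt_exp n (p.2 - 1/2) u hu) s1
  have h2 : HasFDerivAt (fun p : ℝ × ℝ => φ (p.1 - u))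
      ((SchwartzMap.derivCLM ℝ ℝ φ (p.1 - u)) • ContinuousLinearMap.fst ℝ ℝ ℝ) p :=
    ((φ.differentiable.differentiableAt (x := p.1 - u)).hasDerivAt).comp_hasFDerivAt p s2
  have h3 := h1.mul h2
  refine h3.congr_fderiv ?_
  ext <;> simp [fderL] <;> ring

lemma FInt_hasFDerivAt (n : ℕ) (φ : 𝓢(ℝ, ℝ)) (p : ℝ × ℝ) (hp : p.2 ∈ Ioo (0 : ℝ) 1) :
    HasFDerivAt (fun p : ℝ × ℝ => FInt n φ p.1 p.2)
      (FInt n (SchwartzMap.derivCLM ℝ ℝ φ) p.1 p.2 • ContinuousLinearMap.fst ℝ ℝ ℝ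
        + FInt (n + 1) φ p.1 p.2 • ContinuousLinearMap.snd ℝ ℝ ℝ) p := by
  obtain ⟨C1, hC1, b1⟩ := prod_bound n (SchwartzMap.derivCLM ℝ ℝ φ)
  obtain ⟨C2, hC2, b2⟩ := prod_bound (n + 1) φ
  have hs : Metric.ball p.1 1 ×ˢ Ioo (0 : ℝ) 1 ∈ 𝓝 p := by
    apply (Metric.isOpen_ball.prod isOpen_Ioo).mem_nhds
    exact ⟨Metric.mem_ball_self one_pos, hp⟩
  have hp' := hp
  obtain ⟨t0, t1⟩ := hp
  have key := hasFDerivAt_integral_of_dominated_of_fderiv_le (𝕜 := ℝ)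
    (μ := volume.restrict (Ioi (0:ℝ))) (x₀ := p)
    (F := fun (p : ℝ × ℝ) u => kerL n (p.2 - 1/2) u * φ (p.1 - u))
    (F' := fderL n φ) (bound := fun u => (C1 + C2) * (3 + |p.1|) ^ 3 * domW u) hs
    (Filter.Eventually.of_forall fun q => (prod_meas n _ _ φ).aestronglyMeasurable)
    (prod_int n _ _ φ (by linarith) (by linarith))
    (by
      apply AEStronglyMeasurable.add
      · exact (prod_meas n _ _ _).aestronglyMeasurable.smul_const _
      · exact (prod_meas (n + 1) _ _ _).aestronglyMeasurable.smul_const _)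
    (by
      filter_upwards [ae_restrict_mem measurableSet_Ioi] with u hu
      rintro q ⟨hq1, hq2, hq3⟩
      have hW : 0 ≤ domW u := by
        have : (0:ℝ) ≤ u := le_of_lt hu
        unfold domW; split_ifs <;> positivity
      have hq : |q.1| ≤ 1 + |p.1| := by
        rw [Metric.mem_ball, Real.dist_eq] at hq1
        linarith [abs_sub_abs_le_abs_sub q.1 p.1]
      have c1 := b1 (q.2 - 1/2) q.1 u (by linarith) (by linarith) hu
      have c2 := b2 (q.2 - 1/2) q.1 u (by linarith) (by linarith) hu
      have n1 : ‖ContinuousLinearMap.fst ℝ ℝ ℝ‖ ≤ 1 := ContinuousLinearMap.norm_fst_le ℝ ℝ ℝ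
      have n2 : ‖ContinuousLinearMap.snd ℝ ℝ ℝ‖ ≤ 1 := ContinuousLinearMap.norm_snd_le ℝ ℝ ℝ
      have hq3 : (2 + |q.1|) ^ 3 ≤ (3 + |p.1|) ^ 3 := by
        gcongr ?_ ^ 3
        linarith
      calc ‖fderL n φ q u‖
          ≤ ‖kerL n (q.2 - 1/2) u * SchwartzMap.derivCLM ℝ ℝ φ (q.1 - u)‖
              * ‖ContinuousLinearMap.fst ℝ ℝ ℝ‖
            + ‖kerL (n + 1) (q.2 - 1/2) u * φ (q.1 - u)‖ * ‖ContinuousLinearMap.snd ℝ ℝ ℝ‖ := by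
            unfold fderL
            refine (norm_add_le _ _).trans ?_
            rw [norm_smul, norm_smul]
        _ ≤ (C1 * (2 + |q.1|) ^ 3 * domW u) * 1 + (C2 * (2 + |q.1|) ^ 3 * domW u) * 1 := by
            gcongr <;> assumption
        _ = (C1 + C2) * (2 + |q.1|) ^ 3 * domW u := by ring
        _ ≤ _ := by gcongr)
    (domW_int.const_mul _)
    (by
      filter_upwards [ae_restrict_mem measurableSet_Ioi] with u hu
      intro q _
      exact integrand_hasFDerivAt n φ q u hu)
  refine key.congr_fderiv ?_
  unfold fderL
  rw [integral_add, integral_smul_const, integral_smul_const]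
  · rfl
  · exact (prod_int n _ _ _ (by linarith) (by linarith)).smul_const _
  · exact (prod_int (n + 1) _ _ _ (by linarith) (by linarith)).smul_const _

lemma FInt_contDiffOn_nat (k : ℕ) : ∀ (n : ℕ) (φ : 𝓢(ℝ, ℝ)),
    ContDiffOn ℝ k (fun p : ℝ × ℝ => FInt n φ p.1 p.2) (univ ×ˢ Ioo (0 : ℝ) 1) := by
  have ho : IsOpen ((univ : Set ℝ) ×ˢ Ioo (0 : ℝ) 1) := isOpen_univ.prod isOpen_Ioo
  have hd : ∀ (n : ℕ) (φ : 𝓢(ℝ, ℝ)), DifferentiableOn ℝ (fun p : ℝ × ℝ => FInt n φ p.1 p.2)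
      (univ ×ˢ Ioo (0 : ℝ) 1) := fun n φ p hp =>
    (FInt_hasFDerivAt n φ p hp.2).differentiableAt.differentiableWithinAt
  induction k with
  | zero =>
    intro n φ
    exact contDiffOn_zero.mpr (hd n φ).continuousOn
  | succ k ih =>
    intro n φ
    rw [Nat.cast_succ, contDiffOn_succ_iff_fderiv_of_isOpen ho]
    refine ⟨hd n φ, by simp, ?_⟩
    have := ((ih n (SchwartzMap.derivCLM ℝ ℝ φ)).smul_const (ContinuousLinearMap.fst ℝ ℝ ℝ)).add
      ((ih (n + 1) φ).smul_const (ContinuousLinearMap.snd ℝ ℝ ℝ))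
    exact this.congr fun p hp => (FInt_hasFDerivAt n φ p hp.2).fderiv

lemma posRPow_eq (φ : 𝓢(ℝ, ℝ)) (y θ : ℝ) :
    (fun u => posRPow u (θ - 1/2) * φ (y - u))
      = (Ioi (0:ℝ)).indicator (fun u => kerL 0 (θ - 1/2) u * φ (y - u)) := by
  ext u
  by_cases hu : 0 < u
  · simp [posRPow, kerL, hu]
  · simp [posRPow, hu]

lemma PsiFrac_eq (φ : 𝓢(ℝ, ℝ)) (y θ : ℝ) : PsiFrac (fun x => φ x) y θ = FInt 0 φ y θ := by
  rw [FInt, ← integral_indicator measurableSet_Ioi, ← posRPow_eq, PsiFrac,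
    ← integral_sub_left_eq_self _ volume y]
  simp

lemma FInt_hasDerivAt_y (n : ℕ) (φ : 𝓢(ℝ, ℝ)) (y θ : ℝ) (hθ : θ ∈ Ioo (0 : ℝ) 1) :
    HasDerivAt (fun y => FInt n φ y θ) (FInt n (SchwartzMap.derivCLM ℝ ℝ φ) y θ) y := by
  have h := (FInt_hasFDerivAt n φ (y, θ) hθ).comp_hasDerivAt y
    ((hasDerivAt_id y).prodMk (hasDerivAt_const y θ))
  simpa [Function.comp_def] using h

lemma FInt_hasDerivAt_theta (n : ℕ) (φ : 𝓢(ℝ, ℝ)) (y θ : ℝ) (hθ : θ ∈ Ioo (0 : ℝ) 1) :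
    HasDerivAt (fun θ => FInt n φ y θ) (FInt (n + 1) φ y θ) θ := by
  have h := (FInt_hasFDerivAt n φ (y, θ) hθ).comp_hasDerivAt θ
    ((hasDerivAt_const θ y).prodMk (hasDerivAt_id θ))
  simpa [Function.comp_def] using h

lemma iter_theta (φ : 𝓢(ℝ, ℝ)) (y : ℝ) (n : ℕ) : ∀ θ ∈ Ioo (0 : ℝ) 1,
    iteratedDerivWithin n (fun θ' => PsiFrac (fun x => φ x) y θ') (Ioo 0 1) θ = FInt n φ y θ := by
  induction n with
  | zero => intro θ _; simp [PsiFrac_eq]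
  | succ n ih =>
    intro θ hθ
    rw [iteratedDerivWithin_succ, derivWithin_congr ih (ih θ hθ), derivWithin_of_isOpen isOpen_Ioo hθ]
    exact (FInt_hasDerivAt_theta n φ y θ hθ).deriv

lemma iter_y (n : ℕ) (θ : ℝ) (hθ : θ ∈ Ioo (0 : ℝ) 1) (m : ℕ) : ∀ (φ : 𝓢(ℝ, ℝ)),
    iteratedDeriv m (fun y => FInt n φ y θ)
      = fun y => FInt n ((SchwartzMap.derivCLM ℝ ℝ)^[m] φ) y θ := by
  induction m with
  | zero => intro φ; simp
  | succ m ih =>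
    intro φ
    rw [iteratedDeriv_succ', Function.iterate_succ_apply, ← ih]
    congr 1
    ext y
    exact (FInt_hasDerivAt_y n φ y θ hθ).deriv


/-- For a real-valued Schwartz function `ψ` whose Fourier transform vanishes outside
`{2π/3 ≤ |ξ| ≤ 8π/3}`, the function `Ψ(y,θ) = ∫ (y−x)₊^{θ−1/2} ψ(x) dx` is
well-defined and `C^∞` on `ℝ × (0,1)`, and all its partial derivatives are
well-localized in `y`, uniformly in `θ`. -/
theorem psiFrac_smooth_and_localized (ψ : SchwartzMap ℝ ℝ)
    (hsupp : ∀ ξ : ℝ, (|ξ| < 2 * π / 3 ∨ 8 * π / 3 < |ξ|) → fourierT (fun x => ψ x) ξ = 0) :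
    (∀ y : ℝ, ∀ θ ∈ Set.Ioo (0:ℝ) 1,
      Integrable (fun x : ℝ => posRPow (y - x) (θ - 1/2) * ψ x)) ∧
    ContDiffOn ℝ (⊤ : ℕ∞) (fun p : ℝ × ℝ => PsiFrac (fun x => ψ x) p.1 p.2)
      (Set.univ ×ˢ Set.Ioo (0:ℝ) 1) ∧
    ∀ m n : ℕ, ∃ C : ℝ, ∀ y : ℝ, ∀ θ ∈ Set.Ioo (0:ℝ) 1,
      (2 + |y|) ^ 2 * |pder (PsiFrac (fun x => ψ x)) m n y θ| ≤ C := by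
  obtain ⟨χ, hχ⟩ := exists_third_primitive ψ hsupp
  refine ⟨?_, ?_, ?_⟩
  · intro y θ hθ
    obtain ⟨t0, t1⟩ := hθ
    have h : Integrable (fun u => posRPow u (θ - 1/2) * ψ (y - u)) := by
      rw [posRPow_eq, integrable_indicator_iff measurableSet_Ioi]
      exact prod_int 0 _ y ψ (by linarith) (by linarith)
    simpa using h.comp_sub_left y
  · have e : (fun p : ℝ × ℝ => PsiFrac (fun x => ψ x) p.1 p.2)
        = fun p : ℝ × ℝ => FInt 0 ψ p.1 p.2 := by
      ext p
      exact PsiFrac_eq ψ p.1 p.2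
    rw [e]
    exact contDiffOn_infty.mpr fun k => FInt_contDiffOn_nat k 0 ψ
  · intro m n
    obtain ⟨C, hC⟩ := FInt_loc n ((SchwartzMap.derivCLM ℝ ℝ)^[m] χ)
    refine ⟨C, fun y θ hθ => ?_⟩
    have e : pder (PsiFrac (fun x => ψ x)) m n y θ
        = FInt n ((SchwartzMap.derivCLM ℝ ℝ)^[m] ψ) y θ := by
      unfold pder
      have : (fun y' => iteratedDerivWithin n (fun θ' => PsiFrac (fun x => ψ x) y' θ')
          (Set.Ioo 0 1) θ) = fun y' => FInt n ψ y' θ := by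
        ext y'
        exact iter_theta ψ y' n θ hθ
      rw [this, iter_y n θ hθ m ψ]
    rw [e, ← hχ]
    have := hC y θ hθ
    simp only [← Function.iterate_succ_apply' (SchwartzMap.derivCLM ℝ ℝ)] at this
    simp only [← Function.iterate_succ_apply (SchwartzMap.derivCLM ℝ ℝ)]
    exact this

end
end

section
/- Let ψ : ℝ → ℝ be a real-valued Schwartz function whose Fourier transform ψ̂(ξ) = ∫_ℝ e^{−iξx} ψ(x) dx vanishes outside { ξ : 2π/3 ≤ |ξ| ≤ 8π/3 }, and let Ψ(y,θ) = ∫_ℝ (y−x)₊^{θ−1/2} ψ(x) dx. Then for every fixed θ ∈ (0,1), the function y ↦ Ψ(y,θ) is integrable and its Fourier transform satisfies, for all real ξ ≠ 0: ∫_ℝ e^{−iξy} Ψ(y,θ) dy = Γ(θ+1/2) · e^{−i·sgn(ξ)(θ+1/2)π/2} · ψ̂(ξ) / |ξ|^{θ+1/2}, where Γ is the Gamma function Γ(z) = ∫_0^∞ x^{z−1} e^{−x} dx and sgn(ξ) is the sign of ξ. -/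
open MeasureTheory Set Real

noncomputable section

open scoped Topology

lemma aux_int (a ε : ℝ) (ha : -1 < a) (hε : 0 < ε) :
    IntegrableOn (fun u : ℝ => u ^ a * Real.exp (-ε * u)) (Ioi 0) := by
  have := integrableOn_rpow_mul_exp_neg_mul_rpow (p := 1) ha one_pos hε
  simpa using this

lemma aux_norm (a u : ℝ) (hu : 0 < u) (r : ℂ) :
    ‖((u ^ a : ℝ) : ℂ) * Complex.exp (-(r * u))‖ = u ^ a * Real.exp (-r.re * u) := by
  rw [norm_mul, Complex.norm_exp, Complex.norm_real, Real.norm_of_nonneg (by positivity)]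
  simp

lemma aux_meas (a : ℝ) (r : ℂ) : Measurable
    (fun u : ℝ => ((u ^ a : ℝ) : ℂ) * Complex.exp (-(r * u))) := by
  have : Measurable (fun u : ℝ => u ^ a) := measurable_id.pow_const a
  fun_prop

lemma aux_int' (a : ℝ) (r : ℂ) (ha : -1 < a) (hε : 0 < r.re) :
    IntegrableOn (fun u : ℝ => ((u ^ a : ℝ) : ℂ) * Complex.exp (-(r * u))) (Ioi 0) := by
  refine Integrable.mono' (aux_int a r.re ha hε) (aux_meas a r).aestronglyMeasurable ?_
  refine (ae_restrict_iff' measurableSet_Ioi).2 (ae_of_all _ fun u hu => ?_)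
  exact (aux_norm a u hu r).le

lemma aux_gamma (a : ℝ) (ha : -1 < a) (r : ℂ) (hr : 0 < r.re) :
    ∫ u in Ioi (0:ℝ), ((u ^ a : ℝ) : ℂ) * Complex.exp (-(r * u))
      = (1 / r) ^ ((a + 1 : ℝ) : ℂ) * (Real.Gamma (a + 1) : ℂ) := by
  have hopen : IsOpen {z : ℂ | 0 < z.re} := isOpen_lt continuous_const Complex.continuous_re
  have hconv : Convex ℝ {z : ℂ | 0 < z.re} := convex_halfSpace_re_gt 0
  have h1 : AnalyticOnNhd ℂ (fun r : ℂ => ∫ u in Ioi (0:ℝ), ((u ^ a : ℝ) : ℂ) *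
      Complex.exp (-(r * u))) {z : ℂ | 0 < z.re} := by
    refine DifferentiableOn.analyticOnNhd ?_ hopen
    intro z hz
    have hz : 0 < z.re := hz
    have := hasDerivAt_integral_of_dominated_loc_of_deriv_le (μ := volume.restrict (Ioi (0:ℝ)))
      (F := fun (r : ℂ) (u : ℝ) => ((u ^ a : ℝ) : ℂ) * Complex.exp (-(r * u)))
      (F' := fun (r : ℂ) (u : ℝ) => ((u ^ a : ℝ) : ℂ) * (Complex.exp (-(r * u)) * (-u)))
      (x₀ := z) (s := {w : ℂ | z.re / 2 < w.re})
      (bound := fun u => u ^ (a + 1) * Real.exp (-(z.re / 2) * u))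
      ((isOpen_lt continuous_const Complex.continuous_re).mem_nhds (by
        show z.re / 2 < z.re
        linarith))
      (Filter.Eventually.of_forall fun r => (aux_meas a r).aestronglyMeasurable)
      (aux_int' a z ha hz) ?_ ?_ (aux_int (a + 1) (z.re / 2) (by linarith) (by linarith)) ?_
    · exact this.2.differentiableAt.differentiableWithinAt
    · have : Measurable (fun u : ℝ => u ^ a) := measurable_id.pow_const a
      have h : Measurable (fun u : ℝ => ((u ^ a : ℝ) : ℂ) * (Complex.exp (-(z * u)) * (-u))) := by
        fun_prop
      exact h.aestronglyMeasurable
    · refine (ae_restrict_iff' measurableSet_Ioi).2 (ae_of_all _ fun u hu w hw => ?_)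
      have hu : 0 < u := hu
      have hw : z.re / 2 < w.re := hw
      rw [← mul_assoc, norm_mul, aux_norm a u hu, norm_neg, Complex.norm_real,
        Real.norm_of_nonneg hu.le, Real.rpow_add_one hu.ne']
      have : Real.exp (-w.re * u) ≤ Real.exp (-(z.re / 2) * u) := by
        apply Real.exp_le_exp.2
        nlinarith
      calc u ^ a * Real.exp (-w.re * u) * u = u ^ a * u * Real.exp (-w.re * u) := by ring
        _ ≤ _ := by gcongr
    · refine ae_of_all _ fun u w hw => ?_
      have : HasDerivAt (fun r : ℂ => -(r * (u : ℂ))) (-(u : ℂ)) w := by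
        have h := ((hasDerivAt_id w).mul_const (u : ℂ)).neg
        rw [one_mul] at h
        exact h
      exact (this.cexp).const_mul _
  have h2 : AnalyticOnNhd ℂ (fun r : ℂ => (1 / r) ^ ((a + 1 : ℝ) : ℂ) *
      (Real.Gamma (a + 1) : ℂ)) {z : ℂ | 0 < z.re} := by
    refine DifferentiableOn.analyticOnNhd ?_ hopen
    intro z hz
    have hz : 0 < z.re := hz
    have hz0 : z ≠ 0 := by rintro rfl; simp at hz
    have : (1 / z) ∈ Complex.slitPlane := by
      left
      rw [one_div, Complex.inv_re]
      have := Complex.normSq_pos.2 hz0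
      positivity
    refine DifferentiableAt.differentiableWithinAt ?_
    refine DifferentiableAt.mul_const ?_ _
    exact ((differentiableAt_const _).div differentiableAt_id hz0).cpow_const this
  refine AnalyticOnNhd.eqOn_of_preconnected_of_frequently_eq h1 h2 hconv.isPreconnected
    (z₀ := 1) (by simp) ?_ hr
  have hreal : ∀ t : ℝ, 0 < t → ∫ u in Ioi (0:ℝ), ((u ^ a : ℝ) : ℂ) * Complex.exp (-((t:ℂ) * u))
      = (1 / (t:ℂ)) ^ ((a + 1 : ℝ) : ℂ) * (Real.Gamma (a + 1) : ℂ) := by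
    intro t ht
    have := Complex.integral_cpow_mul_exp_neg_mul_Ioi (a := ((a + 1 : ℝ) : ℂ)) (r := t)
      (by rw [Complex.ofReal_re]; linarith) ht
    rw [Complex.Gamma_ofReal] at this
    rw [← this]
    refine setIntegral_congr_fun measurableSet_Ioi fun u hu => ?_
    have hu : 0 < u := hu
    rw [Complex.ofReal_cpow hu.le]
    simp
  have hc : Filter.Tendsto (fun t : ℝ => (t : ℂ)) (𝓝[≠] 1) (𝓝[≠] 1) := by
    refine tendsto_nhdsWithin_iff.2 ⟨?_, ?_⟩
    · have : Filter.Tendsto (fun t : ℝ => (t : ℂ)) (𝓝 1) (𝓝 ((1:ℝ):ℂ)) :=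
        Complex.continuous_ofReal.tendsto 1
      rw [Complex.ofReal_one] at this
      exact this.mono_left nhdsWithin_le_nhds
    · filter_upwards [self_mem_nhdsWithin] with t ht
      simpa using ht
  refine hc.frequently (Filter.Eventually.frequently ?_)
  filter_upwards [mem_nhdsWithin_of_mem_nhds (Ioi_mem_nhds (zero_lt_one' ℝ))] with t ht
  exact hreal t ht

open scoped FourierTransform SchwartzMap ContDiff

lemma aux_dom (a : ℝ) (ha : -1 < a) (ha1 : a ≤ 1) (φ : 𝓢(ℝ, ℂ)) (y : ℝ) :
    IntegrableOn (fun u : ℝ => u ^ a * ‖φ (y - u)‖) (Ioi 0) := by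
  have hm : Measurable (fun u : ℝ => u ^ a) := measurable_id.pow_const a
  have hmφ : Measurable (fun u : ℝ => ‖φ (y - u)‖) :=
    (φ.continuous.comp (continuous_const.sub continuous_id)).norm.measurable
  have hmm : ∀ s : Set ℝ, AEStronglyMeasurable (fun u : ℝ => u ^ a * ‖φ (y - u)‖)
      (volume.restrict s) := fun s => (hm.mul hmφ).aestronglyMeasurable
  obtain ⟨C, hC⟩ : ∃ C, ∀ x, ‖φ x‖ ≤ C :=
    ⟨‖φ.toBoundedContinuousFunction‖, fun x => φ.toBoundedContinuousFunction.norm_coe_le_norm x⟩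
  rw [← Ioc_union_Ioi_eq_Ioi zero_le_one]
  refine IntegrableOn.union ?_ ?_
  · have h1 : IntegrableOn (fun u : ℝ => u ^ a * C) (Ioc 0 1) := by
      have := (intervalIntegral.intervalIntegrable_rpow' (a := 0) (b := 1) ha).1
      exact this.mul_const C
    refine Integrable.mono' h1 (hmm _) ?_
    refine (ae_restrict_iff' measurableSet_Ioc).2 (ae_of_all _ fun u hu => ?_)
    have : 0 < u := hu.1
    rw [norm_mul, norm_norm, Real.norm_of_nonneg (by positivity)]
    gcongr
    exact hC _
  · have h1 : Integrable (fun x : ℝ => |y| * ‖φ x‖ + ‖x‖ ^ 1 * ‖φ x‖) :=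
      (φ.integrable.norm.const_mul _).add (φ.integrable_pow_mul volume 1)
    have h2 := (h1.comp_sub_left y).integrableOn (s := Ioi 1)
    refine Integrable.mono' h2 (hmm _) ?_
    refine (ae_restrict_iff' measurableSet_Ioi).2 (ae_of_all _ fun u hu => ?_)
    have hu : 1 < u := hu
    rw [norm_mul, norm_norm, Real.norm_of_nonneg (by positivity), ← add_mul]
    gcongr
    calc u ^ a ≤ u ^ (1:ℝ) := Real.rpow_le_rpow_of_exponent_le hu.le ha1
      _ = y - (y - u) := by rw [Real.rpow_one]; ring
      _ ≤ |y| + ‖y - u‖ ^ 1 := by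
        rw [pow_one, Real.norm_eq_abs]
        have := le_abs_self y
        have := neg_abs_le (y - u)
        linarith

lemma aux_fubini (a : ℝ) (ha : -1 < a) (φ : 𝓢(ℝ, ℂ)) (y ε : ℝ) (hε : 0 < ε) :
    ∫ u in Ioi (0:ℝ), ((u ^ a : ℝ) : ℂ) * Complex.exp (-(ε * u)) * φ (y - u)
      = ∫ w : ℝ, Complex.exp ((2 * π * w * y : ℝ) * Complex.I) *
          ((1 / ((ε : ℂ) + 2 * π * w * Complex.I)) ^ ((a + 1 : ℝ) : ℂ) *
            (Real.Gamma (a + 1) : ℂ) * 𝓕 φ w) := by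
  have hinv : ∀ x : ℝ, φ x = ∫ w : ℝ, Complex.exp ((2 * π * w * x : ℝ) * Complex.I) * 𝓕 φ w := by
    intro x
    have h : 𝓕⁻ (𝓕 φ) = φ := FourierPair.fourierInv_fourier_eq φ
    have h2 := congrArg (fun f : 𝓢(ℝ, ℂ) => f x) h
    simp only [SchwartzMap.fourierInv_coe] at h2
    rw [← h2, Real.fourierInv_eq']
    refine integral_congr_ae (ae_of_all _ fun w => ?_)
    simp [mul_assoc, mul_comm x w]
  have hI : Integrable (Function.uncurry fun (u w : ℝ) =>
      ((u ^ a : ℝ) : ℂ) * Complex.exp (-(ε * u)) *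
        (Complex.exp ((2 * π * w * (y - u) : ℝ) * Complex.I) * 𝓕 φ w))
      ((volume.restrict (Ioi 0)).prod volume) := by
    have h1 : Integrable (fun p : ℝ × ℝ => (((p.1 ^ a : ℝ) : ℂ) * Complex.exp (-((ε : ℂ) * p.1))) *
      (𝓕 φ p.2)) ((volume.restrict (Ioi 0)).prod volume) :=
      Integrable.mul_prod (aux_int' a (ε : ℂ) ha (by simpa using hε)) (𝓕 φ).integrable
    have h2 : Continuous (fun p : ℝ × ℝ =>
      Complex.exp ((2 * π * p.2 * (y - p.1) : ℝ) * Complex.I)) := by fun_prop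
    have h3 := h1.bdd_mul (c := 1) h2.aestronglyMeasurable (ae_of_all _ fun p => by
      rw [Complex.norm_exp_ofReal_mul_I])
    refine h3.congr (ae_of_all _ fun p => ?_)
    simp only [Function.uncurry]
    ring
  calc _ = ∫ u in Ioi (0:ℝ), ∫ w : ℝ, ((u ^ a : ℝ) : ℂ) * Complex.exp (-(ε * u)) *
        (Complex.exp ((2 * π * w * (y - u) : ℝ) * Complex.I) * 𝓕 φ w) := by
        refine integral_congr_ae (ae_of_all _ fun u => ?_)
        simp only
        rw [integral_const_mul, ← hinv]
    _ = ∫ w : ℝ, ∫ u in Ioi (0:ℝ), ((u ^ a : ℝ) : ℂ) * Complex.exp (-(ε * u)) *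
        (Complex.exp ((2 * π * w * (y - u) : ℝ) * Complex.I) * 𝓕 φ w) :=
        integral_integral_swap hI
    _ = _ := by
        refine integral_congr_ae (ae_of_all _ fun w => ?_)
        simp only
        rw [← aux_gamma a ha _ (by simpa using hε), ← integral_mul_const, ← integral_const_mul]
        refine integral_congr_ae (ae_of_all _ fun u => ?_)
        simp only
        have : Complex.exp (-(((ε : ℂ) + 2 * π * w * Complex.I) * u)) *
            Complex.exp ((2 * π * w * y : ℝ) * Complex.I) = Complex.exp (-(ε * u)) *
            Complex.exp ((2 * π * w * (y - u) : ℝ) * Complex.I) := by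
          rw [← Complex.exp_add, ← Complex.exp_add]
          congr 1
          push_cast
          ring
        linear_combination (-((u ^ a : ℝ) : ℂ) * 𝓕 φ w) * this

lemma aux_slit (ε w : ℝ) (hw : w ≠ 0) :
    1 / ((ε : ℂ) + 2 * π * w * Complex.I) ∈ Complex.slitPlane := by
  right
  rw [one_div, Complex.inv_im]
  have h1 : ((ε : ℂ) + 2 * π * w * Complex.I).im = 2 * π * w := by simp
  have h0 : ((ε : ℂ) + 2 * π * w * Complex.I) ≠ 0 := by
    intro h
    rw [h] at h1
    have := pi_pos
    simp at h1
    exact hw h1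
  rw [h1]
  have hn := Complex.normSq_pos.2 h0
  have := pi_pos
  exact div_ne_zero (neg_ne_zero.2 (by positivity)) hn.ne'

lemma aux_ne (ε w : ℝ) (hw : w ≠ 0) : (ε : ℂ) + 2 * π * w * Complex.I ≠ 0 := by
  intro h
  have := aux_slit ε w hw
  rw [h] at this
  simp at this

lemma aux_limit (a : ℝ) (ha : -1 < a) (ha1 : a ≤ 1) (φ : 𝓢(ℝ, ℂ)) (y : ℝ)
    (h0 : ∀ w : ℝ, |w| < 1 / 3 → 𝓕 φ w = 0) :
    ∫ u in Ioi (0:ℝ), ((u ^ a : ℝ) : ℂ) * φ (y - u)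
      = ∫ w : ℝ, Complex.exp ((2 * π * w * y : ℝ) * Complex.I) *
          ((1 / (((0:ℝ) : ℂ) + 2 * π * w * Complex.I)) ^ ((a + 1 : ℝ) : ℂ) *
            (Real.Gamma (a + 1) : ℂ) * 𝓕 φ w) := by
  have hm : Measurable (fun u : ℝ => u ^ a) := measurable_id.pow_const a
  have hmφ : Measurable (fun u : ℝ => φ (y - u)) :=
    (φ.continuous.comp (continuous_const.sub continuous_id)).measurable
  have hL : Filter.Tendsto (fun ε : ℝ => ∫ u in Ioi (0:ℝ), ((u ^ a : ℝ) : ℂ) *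
      Complex.exp (-(ε * u)) * φ (y - u)) (𝓝[>] 0)
      (𝓝 (∫ u in Ioi (0:ℝ), ((u ^ a : ℝ) : ℂ) * φ (y - u))) := by
    refine tendsto_integral_filter_of_dominated_convergence
      (fun u : ℝ => u ^ a * ‖φ (y - u)‖) ?_ ?_ (aux_dom a ha ha1 φ y) ?_
    · refine Filter.Eventually.of_forall fun ε => ?_
      exact ((aux_meas a ε).mul hmφ).aestronglyMeasurable
    · filter_upwards [self_mem_nhdsWithin] with ε hε
      refine (ae_restrict_iff' measurableSet_Ioi).2 (ae_of_all _ fun u hu => ?_)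
      have hu : 0 < u := hu
      have hε : 0 < ε := hε
      rw [norm_mul, aux_norm a u hu]
      gcongr
      refine mul_le_of_le_one_right (by positivity) ?_
      rw [Real.exp_le_one_iff, Complex.ofReal_re]
      nlinarith
    · refine ae_of_all _ fun u => ?_
      have hc : Continuous (fun ε : ℝ => ((u ^ a : ℝ) : ℂ) *
        Complex.exp (-(ε * u)) * φ (y - u)) := by fun_prop
      have := (hc.tendsto 0).mono_left (nhdsWithin_le_nhds (s := Ioi 0))
      simpa using this
  have hR : Filter.Tendsto (fun ε : ℝ => ∫ w : ℝ, Complex.exp ((2 * π * w * y : ℝ) * Complex.I) *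
          ((1 / ((ε : ℂ) + 2 * π * w * Complex.I)) ^ ((a + 1 : ℝ) : ℂ) *
            (Real.Gamma (a + 1) : ℂ) * 𝓕 φ w)) (𝓝[>] 0)
      (𝓝 (∫ w : ℝ, Complex.exp ((2 * π * w * y : ℝ) * Complex.I) *
          ((1 / (((0:ℝ) : ℂ) + 2 * π * w * Complex.I)) ^ ((a + 1 : ℝ) : ℂ) *
            (Real.Gamma (a + 1) : ℂ) * 𝓕 φ w))) := by
    refine tendsto_integral_filter_of_dominated_convergence
      (fun w : ℝ => ‖(Real.Gamma (a + 1) : ℂ)‖ * ‖𝓕 φ w‖) ?_ ?_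
      ((𝓕 φ).integrable.norm.const_mul _) ?_
    · refine Filter.Eventually.of_forall fun ε => ?_
      have h1 : Measurable (fun w : ℝ => 𝓕 φ w) := (𝓕 φ).continuous.measurable
      have h2 : Measurable (fun w : ℝ =>
        (1 / ((ε : ℂ) + 2 * π * w * Complex.I)) ^ ((a + 1 : ℝ) : ℂ)) := by
        refine Measurable.pow_const ?_ _
        fun_prop
      refine Measurable.aestronglyMeasurable ?_
      fun_prop
    · refine Filter.Eventually.of_forall fun ε => ae_of_all _ fun w => ?_
      by_cases hw : |w| < 1 / 3
      · simp [h0 w hw]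
      · push Not at hw
        rw [norm_mul, Complex.norm_exp_ofReal_mul_I, one_mul, norm_mul, norm_mul,
          Complex.norm_cpow_real]
        have h1 : 1 ≤ ‖(ε : ℂ) + 2 * π * w * Complex.I‖ := by
          have h2 := Complex.abs_im_le_norm ((ε : ℂ) + 2 * π * w * Complex.I)
          have h3 : ((ε : ℂ) + 2 * π * w * Complex.I).im = 2 * π * w := by simp
          rw [h3, abs_mul, abs_of_pos (by positivity)] at h2
          have := pi_gt_three
          nlinarith
        have h4 : ‖1 / ((ε : ℂ) + 2 * π * w * Complex.I)‖ ^ (a + 1) ≤ 1 := by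
          refine Real.rpow_le_one (norm_nonneg _) ?_ (by linarith)
          rw [norm_div, norm_one]
          exact (div_le_one (by linarith)).2 h1
        rw [mul_assoc]
        exact mul_le_of_le_one_left (by positivity) h4
    · refine ae_of_all _ fun w => ?_
      by_cases hw : |w| < 1 / 3
      · simp [h0 w hw]
      · have hw0 : w ≠ 0 := by
          rintro rfl
          norm_num at hw
        have hc : ContinuousAt (fun ε : ℝ =>
            (1 / ((ε : ℂ) + 2 * π * w * Complex.I)) ^ ((a + 1 : ℝ) : ℂ)) 0 := by
          refine ContinuousAt.cpow ?_ continuousAt_const (aux_slit 0 w hw0)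
          refine ContinuousAt.div continuousAt_const (by fun_prop) (aux_ne 0 w hw0)
        have := (hc.tendsto).mono_left (nhdsWithin_le_nhds (s := Ioi 0))
        exact ((this.mul_const _).mul_const _).const_mul _
  refine tendsto_nhds_unique hL (hR.congr' ?_)
  filter_upwards [self_mem_nhdsWithin] with ε hε
  exact (aux_fubini a ha φ y ε hε).symm

lemma aux_schwartz (s : ℝ) (c : ℂ) (h : 𝓢(ℝ, ℂ))
    (h0 : ∀ w : ℝ, |w| < 1 / 3 ∨ 4 / 3 < |w| → h w = 0) :
    ∃ g : 𝓢(ℝ, ℂ), ∀ w, g w =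
      (1 / (((0:ℝ) : ℂ) + 2 * π * w * Complex.I)) ^ (s : ℂ) * c * h w := by
  let g : ℝ → ℂ := fun w => (1 / (((0:ℝ) : ℂ) + 2 * π * w * Complex.I)) ^ (s : ℂ) * c * h w
  have h1 : HasCompactSupport g := by
    refine HasCompactSupport.intro (isCompact_Icc (a := -(4/3 : ℝ)) (b := 4/3)) fun w hw => ?_
    have : 4 / 3 < |w| := by
      by_contra hc
      push Not at hc
      exact hw (abs_le.1 hc)
    simp [g, h0 w (Or.inr this)]
  have h2 : ContDiff ℝ ∞ g := by
    rw [contDiff_iff_contDiffAt]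
    intro w
    by_cases hw : w = 0
    · have : g =ᶠ[𝓝 w] fun _ => 0 := by
        have hn : Metric.ball (0:ℝ) (1/3) ∈ 𝓝 w := by
          rw [hw]
          exact Metric.ball_mem_nhds _ (by norm_num)
        filter_upwards [hn] with x hx
        have : |x| < 1 / 3 := by simpa using hx
        simp [g, h0 x (Or.inl this)]
      exact contDiffAt_const.congr_of_eventuallyEq this
    · have hA : AnalyticAt ℂ (fun z : ℂ => (1 / (((0:ℝ) : ℂ) + 2 * π * z * Complex.I)) ^ (s : ℂ))
          (w : ℂ) := by
        refine AnalyticAt.cpow ?_ analyticAt_const (aux_slit 0 w hw)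
        exact analyticAt_const.div (by fun_prop) (aux_ne 0 w hw)
      have hB : ContDiffAt ℝ ∞ (fun z : ℂ =>
          (1 / (((0:ℝ) : ℂ) + 2 * π * z * Complex.I)) ^ (s : ℂ)) (w : ℂ) :=
        (hA.contDiffAt).restrict_scalars ℝ
      have hC : ContDiffAt ℝ ∞ (fun x : ℝ => (x : ℂ)) w := Complex.ofRealCLM.contDiff.contDiffAt
      have hD := ContDiffAt.comp w hB hC
      exact (hD.mul contDiffAt_const).mul (h.smooth ⊤).contDiffAt
  exact ⟨h1.toSchwartzMap h2, fun w => rfl⟩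

lemma aux_sign (s ξ : ℝ) (hξ : ξ ≠ 0) :
    (1 / ((ξ : ℂ) * Complex.I)) ^ (s : ℂ) =
      Complex.exp (-(Complex.I * (Real.sign ξ : ℝ) * s * π / 2)) / ((|ξ| ^ s : ℝ) : ℂ) := by
  have key : Complex.log (1 / ((ξ : ℂ) * Complex.I)) =
      -(Real.log |ξ| : ℝ) - Complex.I * (Real.sign ξ : ℝ) * π / 2 := by
    have hab : 0 < |ξ| := abs_pos.2 hξ
    rcases lt_or_gt_of_ne hξ with h | h
    · have : 1 / ((ξ : ℂ) * Complex.I) = ((|ξ|⁻¹ : ℝ) : ℂ) * Complex.I := by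
        rw [abs_of_neg h]
        have : (ξ : ℂ) ≠ 0 := by exact_mod_cast hξ
        push_cast
        field_simp
        simp
      rw [this, Complex.log_ofReal_mul (by positivity) Complex.I_ne_zero, Complex.log_I,
        Real.log_inv, Real.sign_of_neg h]
      push_cast
      ring
    · have : 1 / ((ξ : ℂ) * Complex.I) = ((|ξ|⁻¹ : ℝ) : ℂ) * (-Complex.I) := by
        rw [abs_of_pos h]
        have : (ξ : ℂ) ≠ 0 := by exact_mod_cast hξ
        push_cast
        field_simp
        simp
      rw [this, Complex.log_ofReal_mul (by positivity) (neg_ne_zero.2 Complex.I_ne_zero),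
        Complex.log_neg_I, Real.log_inv, Real.sign_of_pos h]
      push_cast
      ring
  have hne : 1 / ((ξ : ℂ) * Complex.I) ≠ 0 := by
    simp [hξ]
  rw [Complex.cpow_def_of_ne_zero hne, key, Real.rpow_def_of_pos (abs_pos.2 hξ), Complex.ofReal_exp,
    ← Complex.exp_sub]
  congr 1
  push_cast
  ring

lemma aux_fourierT (ψ : 𝓢(ℝ, ℝ)) (φ : 𝓢(ℝ, ℂ)) (hφ : ∀ x, φ x = (ψ x : ℂ)) (ξ : ℝ) :
    fourierT (fun x => ψ x) ξ = 𝓕 φ (ξ / (2 * π)) := by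
  rw [SchwartzMap.fourier_coe, Real.fourier_real_eq_integral_exp_smul, fourierT]
  refine integral_congr_ae (ae_of_all _ fun x => ?_)
  simp only [smul_eq_mul, hφ]
  congr 2
  have : (π : ℂ) ≠ 0 := by exact_mod_cast pi_ne_zero
  push_cast
  field_simp

lemma aux_psiFrac (ψ : 𝓢(ℝ, ℝ)) (φ : 𝓢(ℝ, ℂ)) (hφ : ∀ x, φ x = (ψ x : ℂ)) (y θ : ℝ) :
    (PsiFrac (fun x => ψ x) y θ : ℂ) =
      ∫ u in Ioi (0:ℝ), ((u ^ (θ - 1/2) : ℝ) : ℂ) * φ (y - u) := by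
  have h1 : PsiFrac (fun x => ψ x) y θ = ∫ u in Ioi (0:ℝ), u ^ (θ - 1/2) * ψ (y - u) := by
    rw [PsiFrac, ← integral_sub_left_eq_self _ volume y, ← integral_indicator measurableSet_Ioi]
    refine integral_congr_ae (ae_of_all _ fun u => ?_)
    by_cases hu : 0 < u
    · simp [posRPow, hu]
    · simp [posRPow, hu]
  rw [h1, ← integral_complex_ofReal]
  refine integral_congr_ae (ae_of_all _ fun u => ?_)
  simp [hφ]

/-- For every `θ ∈ (0,1)`, `y ↦ Ψ(y,θ)` is integrable and its Fourier transform is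
`Γ(θ+1/2) e^{−i sgn(ξ)(θ+1/2)π/2} ψ̂(ξ) / |ξ|^{θ+1/2}` for all `ξ ≠ 0`. -/
theorem psiFrac_fourier_transform (ψ : SchwartzMap ℝ ℝ)
    (hsupp : ∀ ξ : ℝ, (|ξ| < 2 * π / 3 ∨ 8 * π / 3 < |ξ|) → fourierT (fun x => ψ x) ξ = 0) :
    ∀ θ ∈ Set.Ioo (0:ℝ) 1,
      Integrable (fun y : ℝ => PsiFrac (fun x => ψ x) y θ) ∧
      ∀ ξ : ℝ, ξ ≠ 0 →
        (∫ y : ℝ, Complex.exp (-(Complex.I * ξ * y)) * (PsiFrac (fun x => ψ x) y θ : ℂ))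
          = (Real.Gamma (θ + 1/2) : ℂ)
            * Complex.exp (-(Complex.I * (Real.sign ξ : ℝ) * (θ + 1/2) * π / 2))
            * fourierT (fun x => ψ x) ξ / ((|ξ| ^ (θ + 1/2) : ℝ) : ℂ) := by
  intro θ hθ
  obtain ⟨hθ0, hθ1⟩ := hθ
  let φ : 𝓢(ℝ, ℂ) := ψ.postcompCLM Complex.ofRealCLM
  have hφ : ∀ x, φ x = (ψ x : ℂ) := fun x => rfl
  have hF := aux_fourierT ψ φ hφ
  have h0 : ∀ w : ℝ, |w| < 1 / 3 ∨ 4 / 3 < |w| → 𝓕 φ w = 0 := by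
    intro w hw
    have hpi := pi_pos
    have h := hsupp (2 * π * w) (by
      rw [abs_mul, abs_of_pos (by positivity : 0 < 2 * π)]
      rcases hw with hw | hw
      · left
        nlinarith
      · right
        nlinarith)
    rw [hF] at h
    rwa [mul_div_cancel_left₀ _ (by positivity)] at h
  obtain ⟨g, hg⟩ := aux_schwartz (θ - 1/2 + 1) (Real.Gamma (θ - 1/2 + 1) : ℂ) (𝓕 φ) h0
  have hG : ∀ y : ℝ, (PsiFrac (fun x => ψ x) y θ : ℂ) = 𝓕⁻ g y := by
    intro y
    rw [aux_psiFrac ψ φ hφ, aux_limit (θ - 1/2) (by linarith) (by linarith) φ y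
      (fun w hw => h0 w (Or.inl hw)), SchwartzMap.fourierInv_coe, Real.fourierInv_eq']
    refine integral_congr_ae (ae_of_all _ fun w => ?_)
    simp only [hg, smul_eq_mul]
    congr 4
    simp [mul_assoc, mul_comm y w]
  constructor
  · have h1 : Integrable (fun y : ℝ => (𝓕⁻ g y).re) := (𝓕⁻ g).integrable.re
    refine h1.congr (ae_of_all _ fun y => ?_)
    simp only
    rw [← hG, Complex.ofReal_re]
  · intro ξ hξ
    have h1 : (∫ y : ℝ, Complex.exp (-(Complex.I * ξ * y)) * (PsiFrac (fun x => ψ x) y θ : ℂ))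
        = 𝓕 (𝓕⁻ g) (ξ / (2 * π)) := by
      rw [SchwartzMap.fourier_coe, Real.fourier_real_eq_integral_exp_smul]
      refine integral_congr_ae (ae_of_all _ fun y => ?_)
      simp only [smul_eq_mul, hG]
      congr 2
      have : (π : ℂ) ≠ 0 := by exact_mod_cast pi_ne_zero
      push_cast
      field_simp
    have h2 : 𝓕 (𝓕⁻ g) = g := FourierInvPair.fourier_fourierInv_eq g
    have h3 : ((0:ℝ) : ℂ) + 2 * π * ((ξ / (2 * π) : ℝ) : ℂ) * Complex.I = ξ * Complex.I := by
      have : (π : ℂ) ≠ 0 := by exact_mod_cast pi_ne_zero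
      push_cast
      field_simp
      simp
    rw [h1, h2, hg, h3, aux_sign _ ξ hξ, hF, show θ - 1/2 + 1 = θ + 1/2 by ring]
    push_cast
    ring

end
end
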